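/- arXiv:1802.08956 — 3 statements merged into one kernel-verified Lean document; each statement's English description precedes it below -/
import Mathlib

section
/- Let 1 < p < ∞ and 1 ≤ q ≤ ∞. Convolution is a bounded bilinear map from L^{p,q}(ℝⁿ) × L^1(ℝⁿ) to L^{p,q}(ℝⁿ): there is a constant C with ‖f * g‖_{L^{p,q}} ≤ C ‖f‖_{L^{p,q}} ‖g‖_{L^1}. -/
open MeasureTheory ENNReal Set

/-- Decreasing rearrangement of `‖f‖` with respect to `μ`. -/
noncomputable def rearrangement {α : Type*} [MeasurableSpace α] (μ : Measure α)
    {E : Type*} [NNNorm E] (f : α → E) (t : ℝ) : ℝ≥0∞ :=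
  sInf {s : ℝ≥0∞ | μ {x | s < (‖f x‖₊ : ℝ≥0∞)} ≤ ENNReal.ofReal t}

/-- Lorentz quasi-norm `‖f‖_{L^{p,q}(μ)} = ‖ t^{1/p-1/q} f*(t) ‖_{L^q((0,∞),dt)}`. -/
noncomputable def lorentzNorm {α : Type*} [MeasurableSpace α] (μ : Measure α)
    {E : Type*} [NNNorm E] (p q : ℝ≥0∞) (f : α → E) : ℝ≥0∞ :=
  if q = ∞ then
    ⨆ t ∈ Ioi (0 : ℝ), ENNReal.ofReal (t ^ (p.toReal⁻¹)) * rearrangement μ f t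
  else
    (∫⁻ t in Ioi (0 : ℝ),
        (ENNReal.ofReal (t ^ (p.toReal⁻¹ - q.toReal⁻¹)) * rearrangement μ f t) ^ q.toReal) ^
      q.toReal⁻¹

/-- Convolution of two functions on `ℝⁿ`. -/
noncomputable def conv {n : ℕ} (f g : EuclideanSpace ℝ (Fin n) → ℝ) :
    EuclideanSpace ℝ (Fin n) → ℝ :=
  fun x => ∫ y, f (x - y) * g y

section Rearrangement

variable {α : Type*} [MeasurableSpace α] {μ : Measure α} {E : Type*} [NNNorm E]

lemma antitone_rearrangement (f : α → E) : Antitone (rearrangement μ f) := fun _ _ hst =>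
  sInf_le_sInf fun _ hx => le_trans hx (ENNReal.ofReal_le_ofReal hst)

/-- The rearrangement is the generalized inverse of the distribution function. -/
lemma rearrangement_le_iff (f : α → E) (t : ℝ) (s : ℝ≥0∞) :
    rearrangement μ f t ≤ s ↔ μ {x | s < (‖f x‖₊ : ℝ≥0∞)} ≤ ENNReal.ofReal t := by
  refine ⟨fun h => ?_, fun h => sInf_le h⟩
  rcases eq_or_ne s ∞ with rfl | hs
  · simp
  obtain ⟨u, hu, hsu, hlim⟩ := exists_seq_strictAnti_tendsto' (lt_top_iff_ne_top.2 hs)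
  have hunion : {x | s < (‖f x‖₊ : ℝ≥0∞)} = ⋃ n, {x | u n < (‖f x‖₊ : ℝ≥0∞)} := by
    ext x
    simp only [mem_ofPred_eq, mem_iUnion]
    exact ⟨fun hx => (hlim.eventually_lt_const hx).exists,
      fun ⟨n, hn⟩ => (hsu n).1.trans hn⟩
  have hmono : Monotone fun n => {x | u n < (‖f x‖₊ : ℝ≥0∞)} := fun m n hmn x hx =>
    lt_of_le_of_lt (hu.antitone hmn) hx
  rw [hunion, hmono.measure_iUnion]
  refine iSup_le fun n => ?_
  obtain ⟨v, hv, hvu⟩ := sInf_lt_iff.1 (lt_of_le_of_lt h (hsu n).1)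
  exact (measure_mono fun x hx => lt_trans hvu hx).trans hv

end Rearrangement

lemma volume_Ioi_inter_ofReal_lt (x : ℝ≥0∞) :
    volume {r : ℝ | ENNReal.ofReal r < x ∧ 0 < r} = x := by
  rcases eq_or_ne x ∞ with rfl | hx
  · have : {r : ℝ | ENNReal.ofReal r < ∞ ∧ 0 < r} = Ioi 0 := by ext; simp
    rw [this, Real.volume_Ioi]
  · have : {r : ℝ | ENNReal.ofReal r < x ∧ 0 < r} = Ioo 0 x.toReal := by
      ext r
      simp only [mem_ofPred_eq, mem_Ioo]
      rw [and_comm]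
      refine and_congr_right fun hr => ?_
      rw [ENNReal.ofReal_lt_iff_lt_toReal hr.le hx]
    rw [this, Real.volume_Ioo, sub_zero, ENNReal.ofReal_toReal hx]

/-- Layer cake formula for `ℝ≥0∞`-valued functions. -/
lemma lintegral_eq_lintegral_measure_ofReal_lt {α : Type*} [MeasurableSpace α] {μ : Measure α}
    [SFinite μ] {F : α → ℝ≥0∞} (hF : Measurable F) :
    ∫⁻ x, F x ∂μ = ∫⁻ s in Ioi (0 : ℝ), μ {x | ENNReal.ofReal s < F x} := by
  have hset : MeasurableSet {z : α × ℝ | ENNReal.ofReal z.2 < F z.1} :=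
    measurableSet_lt (by fun_prop) (by fun_prop)
  calc ∫⁻ x, F x ∂μ
      = ∫⁻ x, (∫⁻ s in Ioi (0 : ℝ),
          {z : α × ℝ | ENNReal.ofReal z.2 < F z.1}.indicator 1 (x, s)) ∂μ := by
        refine lintegral_congr fun x => ?_
        have hx : MeasurableSet {s : ℝ | ENNReal.ofReal s < F x} :=
          measurableSet_lt (by fun_prop) (by fun_prop)
        rw [← volume_Ioi_inter_ofReal_lt (F x)]
        change _ = ∫⁻ s in Ioi (0 : ℝ), {s : ℝ | ENNReal.ofReal s < F x}.indicator 1 s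
        rw [lintegral_indicator_one hx, Measure.restrict_apply hx]
        rfl
    _ = ∫⁻ s in Ioi (0 : ℝ), (∫⁻ x,
          {z : α × ℝ | ENNReal.ofReal z.2 < F z.1}.indicator 1 (x, s) ∂μ) :=
        lintegral_lintegral_swap (measurable_one.indicator hset).aemeasurable
    _ = _ := by
        refine lintegral_congr fun s => ?_
        have hs : MeasurableSet {x | ENNReal.ofReal s < F x} :=
          measurableSet_lt (by fun_prop) (by fun_prop)
        rw [← lintegral_indicator_one hs]
        rfl

/-- The excess of a function over a level has the same integral as the excess of its
rearrangement. -/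
lemma lintegral_nnnorm_sub_eq_lintegral_rearrangement_sub {α : Type*} [MeasurableSpace α]
    {μ : Measure α} [SFinite μ] {f : α → ℝ} (hf : Measurable f) (a : ℝ≥0∞) :
    ∫⁻ x, ((‖f x‖₊ : ℝ≥0∞) - a) ∂μ = ∫⁻ r in Ioi (0 : ℝ), (rearrangement μ f r - a) := by
  have hφ : Measurable (rearrangement μ f) := (antitone_rearrangement f).measurable
  rw [lintegral_eq_lintegral_measure_ofReal_lt (by fun_prop),
    lintegral_eq_lintegral_measure_ofReal_lt (hφ.sub_const a)]
  refine lintegral_congr fun s => ?_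
  simp only [lt_tsub_iff_right]
  rw [Measure.restrict_apply (measurableSet_lt (by fun_prop) hφ),
    ← volume_Ioi_inter_ofReal_lt (μ {x | ENNReal.ofReal s + a < (‖f x‖₊ : ℝ≥0∞)})]
  congr 1
  ext r
  simp only [mem_ofPred_eq, mem_inter_iff, mem_Ioi]
  rw [← not_le, ← not_le (a := rearrangement μ f r), rearrangement_le_iff]

lemma setLIntegral_Ioi_comp_mul_left (F : ℝ → ℝ≥0∞) {t : ℝ} (ht : 0 < t) :
    ∫⁻ r in Ioi (0 : ℝ), F r = ENNReal.ofReal t * ∫⁻ s in Ioi (0 : ℝ), F (t * s) := by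
  have himage : (fun s => t * s) '' Ioi (0 : ℝ) = Ioi 0 := by
    rw [Set.image_mul_left_Ioi ht, mul_zero]
  conv_lhs => rw [← himage]
  rw [lintegral_image_eq_lintegral_abs_deriv_mul measurableSet_Ioi
    (fun x _ => ((hasDerivAt_id' x).const_mul t).hasDerivWithinAt)
    (mul_right_injective₀ ht.ne').injOn, lintegral_const_mul' _ _ (by simp)]
  simp [abs_of_pos ht]

/-- Weak-type Markov bound at the critical level. -/
lemma measure_lintegral_div_lt_le {α : Type*} [MeasurableSpace α] {μ : Measure α}
    {H : α → ℝ≥0∞} (hH : AEMeasurable H μ) {t : ℝ≥0∞} (ht : t ≠ 0) (ht' : t ≠ ∞) :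
    μ {x | (∫⁻ y, H y ∂μ) / t < H x} ≤ t := by
  set I := ∫⁻ y, H y ∂μ with hI
  rcases eq_or_ne I ∞ with hItop | hItop
  · simp [hItop, ENNReal.top_div_of_ne_top ht']
  rcases eq_or_ne I 0 with hI0 | hI0
  · have h0 : H =ᵐ[μ] 0 := (lintegral_eq_zero_iff' hH).1 hI0
    have : μ {x | I / t < H x} = 0 := by
      rw [hI0, ENNReal.zero_div]
      refine measure_mono_null (fun x hx => ?_) h0
      exact (ne_of_gt hx : H x ≠ 0)
    simp [this]
  · refine (measure_mono fun x (hx : I / t < H x) => (le_of_lt hx : I / t ≤ H x)).trans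
      ((meas_ge_le_lintegral_div hH (ENNReal.div_ne_zero.2 ⟨hI0, ht'⟩)
        (ENNReal.div_ne_top hItop ht)).trans ?_)
    rw [← hI, ENNReal.div_eq_inv_mul, ENNReal.inv_div (Or.inl ht') (Or.inl ht),
      ENNReal.div_mul_cancel hI0 hItop]

/-- The rearrangement of a convolution is dominated by the averages of the rearrangement. -/
lemma rearrangement_conv_le {n : ℕ} {f g : EuclideanSpace ℝ (Fin n) → ℝ} (hf : Measurable f)
    (hg : AEStronglyMeasurable g volume) {t : ℝ} (ht : 0 < t) :
    rearrangement volume (conv f g) t ≤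
      2 * (∫⁻ y, ‖g y‖ₑ) * ∫⁻ s in Ioo (0 : ℝ) 1, rearrangement volume f (t * s) := by
  set φ := rearrangement volume f
  have hanti : Antitone φ := antitone_rearrangement f
  have hφ : Measurable φ := hanti.measurable
  set G := ∫⁻ y, ‖g y‖ₑ with hG
  set A := ∫⁻ s in Ioo (0 : ℝ) 1, φ (t * s) with hA
  set a := φ t with ha
  have haA : a ≤ A := by
    calc a = ∫⁻ _ in Ioo (0 : ℝ) 1, a := by simp
      _ ≤ A := setLIntegral_mono (by fun_prop) fun s hs =>
          hanti (by nlinarith [hs.2] : t * s ≤ t)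
  let H : EuclideanSpace ℝ (Fin n) → ℝ≥0∞ := fun x => ∫⁻ y, (‖f (x - y)‖ₑ - a) * ‖g y‖ₑ
  have hjoint : AEMeasurable (fun z : EuclideanSpace ℝ (Fin n) × EuclideanSpace ℝ (Fin n) =>
      (‖f (z.1 - z.2)‖ₑ - a) * ‖g z.2‖ₑ) (volume.prod volume) :=
    AEMeasurable.mul (by fun_prop) hg.enorm.comp_snd
  have hH : AEMeasurable H volume := hjoint.lintegral_prod_right'
  have hbound : ∀ x, ‖conv f g x‖ₑ ≤ a * G + H x := by
    intro x
    calc ‖conv f g x‖ₑ ≤ ∫⁻ y, ‖f (x - y) * g y‖ₑ := enorm_integral_le_lintegral_enorm _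
      _ ≤ ∫⁻ y, (a * ‖g y‖ₑ + (‖f (x - y)‖ₑ - a) * ‖g y‖ₑ) := by
          refine lintegral_mono fun y => ?_
          rw [enorm_mul, ← add_mul]
          gcongr
          exact le_add_tsub
      _ = a * G + H x := by
          rw [lintegral_add_left' (hg.enorm.const_mul a), lintegral_const_mul'' _ hg.enorm]
  have hHint : ∫⁻ x, H x ≤ ENNReal.ofReal t * A * G := by
    calc ∫⁻ x, H x = ∫⁻ y, ∫⁻ x, (‖f (x - y)‖ₑ - a) * ‖g y‖ₑ := lintegral_lintegral_swap hjoint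
      _ = ∫⁻ y, (∫⁻ x, (‖f x‖ₑ - a)) * ‖g y‖ₑ := by
          refine lintegral_congr fun y => ?_
          rw [lintegral_mul_const _ (by fun_prop),
            lintegral_sub_right_eq_self (fun x => ‖f x‖ₑ - a) y]
      _ = (∫⁻ x, (‖f x‖ₑ - a)) * G := lintegral_const_mul'' _ hg.enorm
      _ ≤ ENNReal.ofReal t * A * G := by
          gcongr
          refine (lintegral_nnnorm_sub_eq_lintegral_rearrangement_sub hf a).trans_le ?_
          rw [setLIntegral_Ioi_comp_mul_left _ ht]
          gcongr
          rw [hA, ← lintegral_indicator measurableSet_Ioi, ← lintegral_indicator measurableSet_Ioo]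
          refine lintegral_mono fun s => ?_
          by_cases hs : s ∈ Ioo (0 : ℝ) 1
          · simp only [indicator_of_mem hs, indicator_of_mem (show s ∈ Ioi (0 : ℝ) from hs.1)]
            exact tsub_le_self
          · rw [indicator_of_notMem hs]
            by_cases hs0 : s ∈ Ioi (0 : ℝ)
            · have hs1 : 1 ≤ s := not_lt.1 fun h => hs ⟨hs0, h⟩
              rw [indicator_of_mem hs0]
              exact (tsub_eq_zero_of_le (hanti (by nlinarith : t ≤ t * s))).le
            · rw [indicator_of_notMem hs0]
  have ht0 : ENNReal.ofReal t ≠ 0 := by simpa using ht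
  rw [rearrangement_le_iff]
  refine (measure_mono fun x hx => ?_).trans
    (measure_lintegral_div_lt_le hH ht0 ENNReal.ofReal_ne_top)
  have hdiv : (∫⁻ x, H x) / ENNReal.ofReal t ≤ A * G := by
    refine ENNReal.div_le_of_le_mul (hHint.trans_eq ?_)
    ring
  by_contra hle
  rw [mem_ofPred_eq, not_lt] at hle
  refine absurd (lt_of_lt_of_le hx (hbound x)) (not_lt.2 ?_)
  calc a * G + H x ≤ A * G + A * G := by gcongr; exact hle.trans hdiv
    _ = 2 * G * A := by ring

/-- Jensen's inequality for powers over a measure of arbitrary mass. -/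
lemma lintegral_rpow_le_measure_univ_rpow_mul {α : Type*} [MeasurableSpace α] {ν : Measure α}
    {h : α → ℝ≥0∞} (hh : Measurable h) {q : ℝ} (hq : 1 ≤ q) :
    (∫⁻ x, h x ∂ν) ^ q ≤ ν univ ^ (q - 1) * ∫⁻ x, h x ^ q ∂ν := by
  have hq0 : 0 < q := by linarith
  have key := eLpNorm'_le_eLpNorm'_mul_rpow_measure_univ (μ := ν) one_pos hq
    hh.aestronglyMeasurable
  simp only [eLpNorm'_eq_lintegral_enorm, enorm_eq_self, ENNReal.rpow_one, div_one] at key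
  calc (∫⁻ x, h x ∂ν) ^ q
      ≤ ((∫⁻ x, h x ^ q ∂ν) ^ (1 / q) * ν univ ^ (1 - 1 / q)) ^ q := by gcongr
    _ = ν univ ^ (q - 1) * ∫⁻ x, h x ^ q ∂ν := by
      rw [ENNReal.mul_rpow_of_nonneg _ _ hq0.le, ← ENNReal.rpow_mul, ← ENNReal.rpow_mul,
        one_div, inv_mul_cancel₀ hq0.ne', ENNReal.rpow_one, mul_comm, sub_mul, one_mul,
        inv_mul_cancel₀ hq0.ne']

lemma ofReal_rpow_mul_cancel {s : ℝ} (hs : 0 < s) (b : ℝ) (x : ℝ≥0∞) :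
    ENNReal.ofReal (s ^ (-b)) * (ENNReal.ofReal (s ^ b) * x) = x := by
  rw [← mul_assoc, ← ENNReal.ofReal_mul (by positivity), ← Real.rpow_add hs]
  simp

/-- Weighted Hardy inequality for averages `∫₀¹ φ(ts) ds`. -/
lemma lintegral_rpow_average_le {φ : ℝ → ℝ≥0∞} (hφ : Measurable φ) {b q : ℝ} (hq : 1 ≤ q) :
    ∫⁻ t in Ioi (0 : ℝ),
        (ENNReal.ofReal (t ^ (b - q⁻¹)) * ∫⁻ s in Ioo (0 : ℝ) 1, φ (t * s)) ^ q ≤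
      (∫⁻ s in Ioo (0 : ℝ) 1, ENNReal.ofReal (s ^ (-b))) ^ q *
        ∫⁻ t in Ioi (0 : ℝ), (ENNReal.ofReal (t ^ (b - q⁻¹)) * φ t) ^ q := by
  have hq0 : 0 < q := by linarith
  set K := ∫⁻ s in Ioo (0 : ℝ) 1, ENNReal.ofReal (s ^ (-b)) with hK
  set N := ∫⁻ t in Ioi (0 : ℝ), (ENNReal.ofReal (t ^ (b - q⁻¹)) * φ t) ^ q with hN
  let ν : Measure ℝ :=
    (volume.restrict (Ioo (0 : ℝ) 1)).withDensity fun s => ENNReal.ofReal (s ^ (-b))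
  have hw : Measurable fun s : ℝ => ENNReal.ofReal (s ^ (-b)) := by fun_prop
  have hν : ν univ = K := by simp [ν, K]
  have hpoint : ∀ t : ℝ, (ENNReal.ofReal (t ^ (b - q⁻¹)) * ∫⁻ s in Ioo (0 : ℝ) 1, φ (t * s)) ^ q ≤
      K ^ (q - 1) * ∫⁻ s in Ioo (0 : ℝ) 1, ENNReal.ofReal (s ^ (-b)) *
        (ENNReal.ofReal (s ^ b) * (ENNReal.ofReal (t ^ (b - q⁻¹)) * φ (t * s))) ^ q := by
    intro t
    have hmeas : Measurable fun s : ℝ =>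
        ENNReal.ofReal (s ^ b) * (ENNReal.ofReal (t ^ (b - q⁻¹)) * φ (t * s)) := by fun_prop
    have key := lintegral_rpow_le_measure_univ_rpow_mul (ν := ν) hmeas hq
    rw [hν, lintegral_withDensity_eq_lintegral_mul _ hw hmeas,
      lintegral_withDensity_eq_lintegral_mul _ hw (hmeas.pow_const q)] at key
    refine le_trans (le_of_eq ?_) key
    rw [← lintegral_const_mul _ (by fun_prop)]
    congr 1
    exact setLIntegral_congr_fun measurableSet_Ioo fun s hs =>
      (ofReal_rpow_mul_cancel hs.1 b _).symm
  have hscale : ∀ s ∈ Ioo (0 : ℝ) 1, ∫⁻ t in Ioi (0 : ℝ), ENNReal.ofReal (s ^ (-b)) *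
      (ENNReal.ofReal (s ^ b) * (ENNReal.ofReal (t ^ (b - q⁻¹)) * φ (t * s))) ^ q =
      ENNReal.ofReal (s ^ (-b)) * N := by
    intro s hs
    rw [lintegral_const_mul _ (by fun_prop)]
    congr 1
    rw [hN,
      setLIntegral_Ioi_comp_mul_left (fun t => (ENNReal.ofReal (t ^ (b - q⁻¹)) * φ t) ^ q) hs.1,
      ← lintegral_const_mul _ (by fun_prop)]
    refine setLIntegral_congr_fun measurableSet_Ioi fun t ht => ?_
    have ht : 0 < t := ht
    have hs0 : 0 < s := hs.1
    have hexp : s ^ b * t ^ (b - q⁻¹) = s ^ q⁻¹ * (s * t) ^ (b - q⁻¹) := by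
      rw [Real.mul_rpow hs0.le ht.le, ← mul_assoc, ← Real.rpow_add hs0]
      simp
    have hsq : ENNReal.ofReal s = ENNReal.ofReal (s ^ q⁻¹) ^ q := by
      rw [ENNReal.ofReal_rpow_of_pos (by positivity), ← Real.rpow_mul hs0.le,
        inv_mul_cancel₀ hq0.ne', Real.rpow_one]
    rw [hsq, ← ENNReal.mul_rpow_of_nonneg _ _ hq0.le, ← mul_assoc, ← mul_assoc,
      ← ENNReal.ofReal_mul (by positivity), ← ENNReal.ofReal_mul (by positivity), hexp,
      mul_comm t s]
  calc _ ≤ ∫⁻ t in Ioi (0 : ℝ), K ^ (q - 1) * ∫⁻ s in Ioo (0 : ℝ) 1, ENNReal.ofReal (s ^ (-b)) *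
        (ENNReal.ofReal (s ^ b) * (ENNReal.ofReal (t ^ (b - q⁻¹)) * φ (t * s))) ^ q :=
        lintegral_mono fun t => hpoint t
    _ = K ^ (q - 1) * ∫⁻ t in Ioi (0 : ℝ), ∫⁻ s in Ioo (0 : ℝ) 1, ENNReal.ofReal (s ^ (-b)) *
        (ENNReal.ofReal (s ^ b) * (ENNReal.ofReal (t ^ (b - q⁻¹)) * φ (t * s))) ^ q :=
        lintegral_const_mul _ (Measurable.lintegral_prod_right' (f := fun z : ℝ × ℝ =>
          ENNReal.ofReal (z.2 ^ (-b)) * (ENNReal.ofReal (z.2 ^ b) *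
            (ENNReal.ofReal (z.1 ^ (b - q⁻¹)) * φ (z.1 * z.2))) ^ q) (by fun_prop))
    _ = K ^ (q - 1) * ∫⁻ s in Ioo (0 : ℝ) 1, ENNReal.ofReal (s ^ (-b)) * N := by
        rw [lintegral_lintegral_swap (by fun_prop)]
        congr 1
        exact setLIntegral_congr_fun measurableSet_Ioo hscale
    _ = K ^ q * N := by
        rw [lintegral_mul_const _ hw, ← hK, ← mul_assoc]
        congr 1
        conv_lhs => rw [← ENNReal.rpow_one K, ← ENNReal.rpow_mul, one_mul]
        rw [← ENNReal.rpow_add_of_nonneg _ _ (by linarith) zero_le_one]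
        simp

lemma setLIntegral_Ioo_rpow_neg_lt_top {b : ℝ} (hb : b < 1) :
    ∫⁻ s in Ioo (0 : ℝ) 1, ENNReal.ofReal (s ^ (-b)) < ∞ := by
  have h := (intervalIntegral.intervalIntegrable_rpow' (a := 0) (b := 1)
    (by linarith : -1 < -b)).1.mono_set Ioo_subset_Ioc_self
  exact h.lintegral_lt_top

/-- convolution is bounded from `L^{p,q}(ℝⁿ) × L¹(ℝⁿ)` to `L^{p,q}(ℝⁿ)`. -/
theorem lorentzNorm_conv_l1 (n : ℕ) (p q : ℝ≥0∞) (hp : 1 < p) (hp' : p ≠ ∞) (hq : 1 ≤ q) :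
    ∃ C : ℝ≥0∞, C < ∞ ∧ ∀ f g : EuclideanSpace ℝ (Fin n) → ℝ,
      Measurable f → Integrable g volume →
      lorentzNorm volume p q (conv f g) ≤ C * lorentzNorm volume p q f * eLpNorm g 1 volume := by
  set b := p.toReal⁻¹ with hb
  have hb1 : b < 1 := inv_lt_one_of_one_lt₀ <| by
    simpa using (ENNReal.toReal_lt_toReal ENNReal.one_ne_top hp').2 hp
  set K := ∫⁻ s in Ioo (0 : ℝ) 1, ENNReal.ofReal (s ^ (-b)) with hK
  refine ⟨2 * K, ENNReal.mul_lt_top (by simp) (setLIntegral_Ioo_rpow_neg_lt_top hb1),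
    fun f g hf hg => ?_⟩
  have hφ : Measurable (rearrangement volume f) := (antitone_rearrangement f).measurable
  have hconv : ∀ t ∈ Ioi (0 : ℝ), _ := fun t ht => rearrangement_conv_le hf hg.1 ht
  have hG : ∫⁻ y, ‖g y‖ₑ ≠ ∞ := hg.2.ne
  rw [eLpNorm_one_eq_lintegral_enorm]
  set G := ∫⁻ y, ‖g y‖ₑ
  unfold lorentzNorm
  rw [← hb]
  split_ifs with hqtop
  · set M := ⨆ t ∈ Ioi (0 : ℝ), ENNReal.ofReal (t ^ b) * rearrangement volume f t
    refine iSup₂_le fun t ht => ?_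
    have ht0 : 0 < t := ht
    calc ENNReal.ofReal (t ^ b) * rearrangement volume (conv f g) t
        ≤ ENNReal.ofReal (t ^ b) *
          (2 * G * ∫⁻ s in Ioo (0 : ℝ) 1, rearrangement volume f (t * s)) := by
          gcongr
          exact hconv t ht
      _ = 2 * G * ∫⁻ s in Ioo (0 : ℝ) 1,
            ENNReal.ofReal (t ^ b) * rearrangement volume f (t * s) := by
          rw [lintegral_const_mul _ (by fun_prop)]
          ring
      _ ≤ 2 * G * ∫⁻ s in Ioo (0 : ℝ) 1, ENNReal.ofReal (s ^ (-b)) * M := by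
          refine mul_le_mul' le_rfl ?_
          refine setLIntegral_mono' measurableSet_Ioo fun s hs => ?_
          rw [← ofReal_rpow_mul_cancel hs.1 b
            (ENNReal.ofReal (t ^ b) * rearrangement volume f (t * s)), ← mul_assoc
            (ENNReal.ofReal (s ^ b)), ← ENNReal.ofReal_mul (Real.rpow_nonneg hs.1.le b),
            ← Real.mul_rpow hs.1.le ht0.le, mul_comm s t]
          gcongr
          exact le_iSup₂ (f := fun t (_ : t ∈ Ioi (0 : ℝ)) =>
            ENNReal.ofReal (t ^ b) * rearrangement volume f t) (t * s) (mul_pos ht0 hs.1)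
      _ = 2 * K * M * G := by
          rw [lintegral_mul_const _ (by fun_prop), ← hK]
          ring
  · have hq1 : 1 ≤ q.toReal := by
      simpa using (ENNReal.toReal_le_toReal ENNReal.one_ne_top hqtop).2 hq
    have hq0 : 0 < q.toReal := by linarith
    set r := q.toReal
    set N := ∫⁻ t in Ioi (0 : ℝ),
      (ENNReal.ofReal (t ^ (b - r⁻¹)) * rearrangement volume f t) ^ r with hN
    have hle : ∫⁻ t in Ioi (0 : ℝ),
        (ENNReal.ofReal (t ^ (b - r⁻¹)) * rearrangement volume (conv f g) t) ^ r ≤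
        (2 * G * K) ^ r * N := by
      calc _ ≤ ∫⁻ t in Ioi (0 : ℝ), (2 * G) ^ r * (ENNReal.ofReal (t ^ (b - r⁻¹)) *
              ∫⁻ s in Ioo (0 : ℝ) 1, rearrangement volume f (t * s)) ^ r := by
            refine setLIntegral_mono' measurableSet_Ioi fun t ht => ?_
            rw [← ENNReal.mul_rpow_of_nonneg _ _ hq0.le, mul_left_comm]
            gcongr
            exact hconv t ht
        _ ≤ (2 * G) ^ r * (K ^ r * N) := by
            rw [lintegral_const_mul' _ _ (ENNReal.rpow_ne_top_of_nonneg hq0.le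
              (ENNReal.mul_ne_top (by simp) hG))]
            gcongr
            exact lintegral_rpow_average_le hφ hq1
        _ = (2 * G * K) ^ r * N := by
            rw [ENNReal.mul_rpow_of_nonneg (2 * G) K hq0.le, mul_assoc]
    calc _ ≤ ((2 * G * K) ^ r * N) ^ r⁻¹ := by gcongr
      _ = 2 * K * N ^ r⁻¹ * G := by
          rw [ENNReal.mul_rpow_of_nonneg _ _ (by positivity), ENNReal.rpow_rpow_inv hq0.ne']
          ring
end

section
/- Let 1 < p < ∞, 1 ≤ q ≤ ∞, and let p', q' be the conjugate exponents. Then convolution is bounded from L^{p,q}(ℝⁿ) × L^{p',q'}(ℝⁿ) to L^∞(ℝⁿ): there is a constant C with ‖f * g‖_{L^∞} ≤ C ‖f‖_{L^{p,q}} ‖g‖_{L^{p',q'}}. -/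
open MeasureTheory ENNReal Set

theorem lintegral_indicator_ofReal_lt (a : ℝ≥0∞) :
    ∫⁻ t in Ioi (0 : ℝ), {t : ℝ | ENNReal.ofReal t < a}.indicator 1 t = a := by
  have hm : MeasurableSet {t : ℝ | ENNReal.ofReal t < a} :=
    measurableSet_lt ENNReal.measurable_ofReal measurable_const
  rw [lintegral_indicator_one hm, Measure.restrict_apply hm]
  rcases eq_or_ne a ∞ with rfl | ha
  · simp
  · have : {t : ℝ | ENNReal.ofReal t < a} ∩ Ioi 0 = Ioo 0 a.toReal := by
      ext t
      simp only [mem_inter_iff, mem_ofPred_eq, mem_Ioi, mem_Ioo]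
      rw [and_comm]
      exact and_congr_right fun ht => ENNReal.ofReal_lt_iff_lt_toReal ht.le ha
    rw [this, Real.volume_Ioo, sub_zero, ENNReal.ofReal_toReal ha]

theorem lintegral_indicator_ofReal_le (a : ℝ≥0∞) :
    ∫⁻ t in Ioi (0 : ℝ), {t : ℝ | ENNReal.ofReal t ≤ a}.indicator 1 t = a := by
  have hm : MeasurableSet {t : ℝ | ENNReal.ofReal t ≤ a} :=
    measurableSet_le ENNReal.measurable_ofReal measurable_const
  rw [lintegral_indicator_one hm, Measure.restrict_apply hm]
  rcases eq_or_ne a ∞ with rfl | ha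
  · simp
  · have : {t : ℝ | ENNReal.ofReal t ≤ a} ∩ Ioi 0 = Ioc 0 a.toReal := by
      ext t
      simp only [mem_inter_iff, mem_ofPred_eq, mem_Ioi, mem_Ioc]
      rw [and_comm]
      exact and_congr_right fun _ => ENNReal.ofReal_le_iff_le_toReal ha
    rw [this, Real.volume_Ioc, sub_zero, ENNReal.ofReal_toReal ha]

section Rearrangement

variable {α : Type*} [MeasurableSpace α] {μ : Measure α} {E : Type*} [NNNorm E]

theorem rearrangement_antitone (μ : Measure α) (f : α → E) : Antitone (rearrangement μ f) :=
  fun _ _ hab => sInf_le_sInf fun _ hs => le_trans hs (ENNReal.ofReal_le_ofReal hab)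

theorem measurable_rearrangement (μ : Measure α) (f : α → E) : Measurable (rearrangement μ f) :=
  (rearrangement_antitone μ f).measurable

theorem le_rearrangement {f : α → E} {s : ℝ≥0∞} {t : ℝ}
    (h : ENNReal.ofReal t < μ {x | s < (‖f x‖₊ : ℝ≥0∞)}) : s ≤ rearrangement μ f t := by
  refine le_sInf fun r hr => ?_
  by_contra! hrs
  exact absurd (h.trans_le ((measure_mono fun x hx => hrs.trans hx).trans hr)) (lt_irrefl _)

theorem rearrangement_comp {β : Type*} [MeasurableSpace β] {ν : Measure β} {e : β → α}
    (he : MeasurePreserving e ν μ) {f : α → E}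
    (hf : Measurable fun x => (‖f x‖₊ : ℝ≥0∞)) :
    rearrangement ν (f ∘ e) = rearrangement μ f := by
  ext t
  have (s : ℝ≥0∞) : ν {x | s < (‖(f ∘ e) x‖₊ : ℝ≥0∞)} = μ {x | s < (‖f x‖₊ : ℝ≥0∞)} :=
    he.measure_preimage (measurableSet_lt measurable_const hf).nullMeasurableSet
  simp only [rearrangement, this]

/-- The Hardy–Littlewood rearrangement inequality. -/
theorem lintegral_mul_le_lintegral_rearrangement_mul [SFinite μ] {f g : α → E}
    (hf : Measurable fun x => (‖f x‖₊ : ℝ≥0∞)) (hg : Measurable fun x => (‖g x‖₊ : ℝ≥0∞)) :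
    ∫⁻ x, (‖f x‖₊ : ℝ≥0∞) * ‖g x‖₊ ∂μ ≤
      ∫⁻ t in Ioi (0 : ℝ), rearrangement μ f t * rearrangement μ g t := by
  set ν : Measure ℝ := volume.restrict (Ioi 0)
  have hmf := measurable_rearrangement μ f
  have hmg := measurable_rearrangement μ g
  have hlt (a : ℝ≥0∞) : AEMeasurable ({s : ℝ | ENNReal.ofReal s < a}.indicator (1 : ℝ → ℝ≥0∞)) ν :=
    (measurable_one.indicator
      (measurableSet_lt ENNReal.measurable_ofReal measurable_const)).aemeasurable
  have hle (a : ℝ≥0∞) : AEMeasurable ({s : ℝ | ENNReal.ofReal s ≤ a}.indicator (1 : ℝ → ℝ≥0∞)) ν :=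
    (measurable_one.indicator
      (measurableSet_le ENNReal.measurable_ofReal measurable_const)).aemeasurable
  have hA : MeasurableSet {w : α × ℝ × ℝ | ENNReal.ofReal w.2.1 < ‖f w.1‖₊ ∧
      ENNReal.ofReal w.2.2 < ‖g w.1‖₊} :=
    (measurableSet_lt (by fun_prop) (hf.comp measurable_fst)).inter
      (measurableSet_lt (by fun_prop) (hg.comp measurable_fst))
  have hB : MeasurableSet {w : (ℝ × ℝ) × ℝ | ENNReal.ofReal w.1.1 ≤ rearrangement μ f w.2 ∧
      ENNReal.ofReal w.1.2 ≤ rearrangement μ g w.2} :=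
    MeasurableSet.inter
      (measurableSet_le (f := fun w : (ℝ × ℝ) × ℝ => ENNReal.ofReal w.1.1)
        (by fun_prop) (hmf.comp measurable_snd))
      (measurableSet_le (f := fun w : (ℝ × ℝ) × ℝ => ENNReal.ofReal w.1.2)
        (by fun_prop) (hmg.comp measurable_snd))
  calc ∫⁻ x, (‖f x‖₊ : ℝ≥0∞) * ‖g x‖₊ ∂μ
      = ∫⁻ x, ∫⁻ z, {w : α × ℝ × ℝ | ENNReal.ofReal w.2.1 < ‖f w.1‖₊ ∧
          ENNReal.ofReal w.2.2 < ‖g w.1‖₊}.indicator 1 (x, z) ∂(ν.prod ν) ∂μ := by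
        refine lintegral_congr fun x => ?_
        conv_lhs => rw [← lintegral_indicator_ofReal_lt (‖f x‖₊ : ℝ≥0∞),
          ← lintegral_indicator_ofReal_lt (‖g x‖₊ : ℝ≥0∞),
          ← lintegral_prod_mul (hlt _) (hlt _)]
        refine lintegral_congr fun z => ?_
        simp only [indicator_apply, mem_ofPred_eq, Pi.one_apply]
        split_ifs <;> simp_all
    _ = ∫⁻ z, ∫⁻ x, {w : α × ℝ × ℝ | ENNReal.ofReal w.2.1 < ‖f w.1‖₊ ∧
          ENNReal.ofReal w.2.2 < ‖g w.1‖₊}.indicator 1 (x, z) ∂μ ∂(ν.prod ν) :=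
        lintegral_lintegral_swap (measurable_one.indicator hA).aemeasurable
    _ ≤ ∫⁻ z, ∫⁻ t, {w : (ℝ × ℝ) × ℝ | ENNReal.ofReal w.1.1 ≤ rearrangement μ f w.2 ∧
          ENNReal.ofReal w.1.2 ≤ rearrangement μ g w.2}.indicator 1 (z, t) ∂ν ∂(ν.prod ν) := by
        refine lintegral_mono fun z => ?_
        have hz : ∫⁻ x, {w : α × ℝ × ℝ | ENNReal.ofReal w.2.1 < ‖f w.1‖₊ ∧
            ENNReal.ofReal w.2.2 < ‖g w.1‖₊}.indicator 1 (x, z) ∂μ =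
            μ ({x | ENNReal.ofReal z.1 < ‖f x‖₊} ∩ {x | ENNReal.ofReal z.2 < ‖g x‖₊}) := by
          rw [← lintegral_indicator_one ((measurableSet_lt measurable_const hf).inter
            (measurableSet_lt measurable_const hg))]
          rfl
        rw [hz]
        refine (le_min (measure_mono inter_subset_left) (measure_mono inter_subset_right)).trans ?_
        conv_lhs => rw [← lintegral_indicator_ofReal_lt (min _ _)]
        refine lintegral_mono ?_
        refine indicator_le fun t ht => ?_
        rw [mem_ofPred_eq, lt_min_iff] at ht
        rw [indicator_of_mem]
        · rfl
        · exact ⟨le_rearrangement ht.1, le_rearrangement ht.2⟩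
    _ = ∫⁻ t, ∫⁻ z, {w : (ℝ × ℝ) × ℝ | ENNReal.ofReal w.1.1 ≤ rearrangement μ f w.2 ∧
          ENNReal.ofReal w.1.2 ≤ rearrangement μ g w.2}.indicator 1 (z, t) ∂(ν.prod ν) ∂ν :=
        lintegral_lintegral_swap (measurable_one.indicator hB).aemeasurable
    _ = ∫⁻ t, rearrangement μ f t * rearrangement μ g t ∂ν := by
        refine lintegral_congr fun t => ?_
        conv_rhs => rw [← lintegral_indicator_ofReal_le (rearrangement μ f t),
          ← lintegral_indicator_ofReal_le (rearrangement μ g t),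
          ← lintegral_prod_mul (hle _) (hle _)]
        refine lintegral_congr fun z => ?_
        simp only [indicator_apply, mem_ofPred_eq, Pi.one_apply]
        split_ifs <;> simp_all

theorem lintegral_rearrangement_mul_le_lorentzNorm_one_mul_lorentzNorm_top {p p' : ℝ≥0∞}
    (hp : p.toReal⁻¹ + p'.toReal⁻¹ = 1) (f g : α → E) :
    ∫⁻ t in Ioi (0 : ℝ), rearrangement μ f t * rearrangement μ g t ≤
      lorentzNorm μ p 1 f * lorentzNorm μ p' ∞ g := by
  have hmf := measurable_rearrangement μ f
  simp only [lorentzNorm, one_ne_top, if_false, if_true, toReal_one, inv_one, ENNReal.rpow_one]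
  rw [← lintegral_mul_const _ (by fun_prop)]
  refine setLIntegral_mono (by fun_prop) fun t ht => ?_
  have h1 : ENNReal.ofReal (t ^ (p.toReal⁻¹ - 1)) * ENNReal.ofReal (t ^ p'.toReal⁻¹) = 1 := by
    rw [← ENNReal.ofReal_mul (Real.rpow_nonneg (le_of_lt ht) _), ← Real.rpow_add ht,
      show p.toReal⁻¹ - 1 + p'.toReal⁻¹ = 0 by linarith, Real.rpow_zero, ENNReal.ofReal_one]
  calc rearrangement μ f t * rearrangement μ g t
      = ENNReal.ofReal (t ^ (p.toReal⁻¹ - 1)) * rearrangement μ f t *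
          (ENNReal.ofReal (t ^ p'.toReal⁻¹) * rearrangement μ g t) := by
        rw [mul_mul_mul_comm, h1, one_mul]
    _ ≤ _ := by
        gcongr
        exact le_iSup₂ (f := fun t (_ : t ∈ Ioi (0 : ℝ)) =>
          ENNReal.ofReal (t ^ p'.toReal⁻¹) * rearrangement μ g t) t ht

theorem lintegral_rearrangement_mul_le_lorentzNorm_mul_lorentzNorm_of_ne_top {p q p' q' : ℝ≥0∞}
    (hp : p.toReal⁻¹ + p'.toReal⁻¹ = 1) (hq : q ≠ ∞) (hq' : q' ≠ ∞)
    (hqc : q.toReal.HolderConjugate q'.toReal) (f g : α → E) :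
    ∫⁻ t in Ioi (0 : ℝ), rearrangement μ f t * rearrangement μ g t ≤
      lorentzNorm μ p q f * lorentzNorm μ p' q' g := by
  have hmf := measurable_rearrangement μ f
  have hmg := measurable_rearrangement μ g
  simp only [lorentzNorm, hq, hq', if_false]
  have holder := ENNReal.lintegral_mul_le_Lp_mul_Lq (volume.restrict (Ioi (0 : ℝ))) hqc
    (f := fun t => ENNReal.ofReal (t ^ (p.toReal⁻¹ - q.toReal⁻¹)) * rearrangement μ f t)
    (g := fun t => ENNReal.ofReal (t ^ (p'.toReal⁻¹ - q'.toReal⁻¹)) * rearrangement μ g t)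
    (by fun_prop) (by fun_prop)
  simp only [one_div] at holder
  refine le_trans (le_of_eq ?_) holder
  refine setLIntegral_congr_fun measurableSet_Ioi fun t ht => ?_
  have h1 : ENNReal.ofReal (t ^ (p.toReal⁻¹ - q.toReal⁻¹)) *
      ENNReal.ofReal (t ^ (p'.toReal⁻¹ - q'.toReal⁻¹)) = 1 := by
    have := hqc.inv_add_inv_eq_one
    rw [← ENNReal.ofReal_mul (Real.rpow_nonneg (le_of_lt ht) _), ← Real.rpow_add ht,
      show p.toReal⁻¹ - q.toReal⁻¹ + (p'.toReal⁻¹ - q'.toReal⁻¹) = 0 by linarith,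
      Real.rpow_zero, ENNReal.ofReal_one]
  simp only [Pi.mul_apply]
  rw [mul_mul_mul_comm, h1, one_mul]

/-- Hölder's inequality for rearrangements in Lorentz spaces. -/
theorem lintegral_rearrangement_mul_le_lorentzNorm_mul_lorentzNorm {p q p' q' : ℝ≥0∞}
    (hp : p.toReal⁻¹ + p'.toReal⁻¹ = 1) (hqc : q⁻¹ + q'⁻¹ = 1) (f g : α → E) :
    ∫⁻ t in Ioi (0 : ℝ), rearrangement μ f t * rearrangement μ g t ≤
      lorentzNorm μ p q f * lorentzNorm μ p' q' g := by
  rcases eq_or_ne q ∞ with rfl | hq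
  · obtain rfl : q' = 1 := by simpa using hqc
    simp only [mul_comm (rearrangement μ f _), mul_comm (lorentzNorm μ p ∞ f)]
    exact lintegral_rearrangement_mul_le_lorentzNorm_one_mul_lorentzNorm_top (by rwa [add_comm]) g f
  rcases eq_or_ne q' ∞ with rfl | hq'
  · obtain rfl : q = 1 := by simpa using hqc
    exact lintegral_rearrangement_mul_le_lorentzNorm_one_mul_lorentzNorm_top hp f g
  refine lintegral_rearrangement_mul_le_lorentzNorm_mul_lorentzNorm_of_ne_top hp hq hq' ?_ f g
  have h0 : q⁻¹ ≠ ∞ := fun h => by simp [h] at hqc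
  have h0' : q'⁻¹ ≠ ∞ := fun h => by simp [h] at hqc
  have hs : q.toReal⁻¹ + q'.toReal⁻¹ = 1 := by
    rw [← ENNReal.toReal_inv, ← ENNReal.toReal_inv, ← ENNReal.toReal_add h0 h0', hqc, toReal_one]
  refine ⟨by simpa using hs, ENNReal.toReal_pos ?_ hq, ENNReal.toReal_pos ?_ hq'⟩
  · simpa using h0
  · simpa using h0'

end Rearrangement

/-- convolution is bounded from `L^{p,q}(ℝⁿ) × L^{p',q'}(ℝⁿ)` to `L^∞(ℝⁿ)`. -/
theorem lorentzNorm_conv_dual (n : ℕ) (p q p' q' : ℝ≥0∞)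
    (hp : 1 < p) (hp'' : p ≠ ∞) (hq : 1 ≤ q)
    (hpc : p⁻¹ + p'⁻¹ = 1) (hqc : q⁻¹ + q'⁻¹ = 1) :
    ∃ C : ℝ≥0∞, C < ∞ ∧ ∀ f g : EuclideanSpace ℝ (Fin n) → ℝ,
      Measurable f → Measurable g →
      eLpNorm (conv f g) ∞ volume ≤
        C * lorentzNorm volume p q f * lorentzNorm volume p' q' g := by
  have h0 : p⁻¹ ≠ ∞ := fun h => by simp [h] at hpc
  have h0' : p'⁻¹ ≠ ∞ := fun h => by simp [h] at hpc
  have hs : p.toReal⁻¹ + p'.toReal⁻¹ = 1 := by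
    rw [← ENNReal.toReal_inv, ← ENNReal.toReal_inv, ← ENNReal.toReal_add h0 h0', hpc, toReal_one]
  refine ⟨1, one_lt_top, fun f g hf hg => ?_⟩
  rw [one_mul, eLpNorm_exponent_top]
  refine eLpNormEssSup_le_of_ae_enorm_bound (ae_of_all _ fun x => ?_)
  have hre : rearrangement volume (fun y => f (x - y)) = rearrangement volume f :=
    rearrangement_comp (volume.measurePreserving_sub_left x) (by fun_prop)
  calc ‖conv f g x‖ₑ ≤ ∫⁻ y, ‖f (x - y) * g y‖ₑ := enorm_integral_le_lintegral_enorm _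
    _ = ∫⁻ y, (‖f (x - y)‖₊ : ℝ≥0∞) * ‖g y‖₊ := by simp only [enorm_mul]; rfl
    _ ≤ ∫⁻ t in Ioi (0 : ℝ), rearrangement volume (fun y => f (x - y)) t *
          rearrangement volume g t :=
        lintegral_mul_le_lintegral_rearrangement_mul (by fun_prop) (by fun_prop)
    _ ≤ _ := by
        rw [hre]
        exact lintegral_rearrangement_mul_le_lorentzNorm_mul_lorentzNorm hs hqc f g
end

section
/- Let 1 < p, p₁, p₂ < ∞ and 1 ≤ q, q₁, q₂ ≤ ∞ with 1 + 1/p₂ = 1/p + 1/p₁ and 1/q₂ = 1/q + 1/q₁. Then convolution is a bounded bilinear map from L^{p,q}(ℝⁿ) × L^{p₁,q₁}(ℝⁿ) to L^{p₂,q₂}(ℝⁿ) (Young's convolution inequality in Lorentz spaces). -/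
open MeasureTheory ENNReal Set

section Rearrangement

variable {α : Type*} [MeasurableSpace α] {μ : Measure α}

/-- Decreasing rearrangement of an `ℝ≥0∞`-valued function. -/
noncomputable def decRearr (μ : Measure α) (F : α → ℝ≥0∞) (t : ℝ) : ℝ≥0∞ :=
  sInf {s : ℝ≥0∞ | μ {x | s < F x} ≤ ENNReal.ofReal t}

theorem decRearr_antitone (F : α → ℝ≥0∞) : Antitone (decRearr μ F) := by
  intro s t hst
  exact sInf_le_sInf fun u hu => le_trans hu (ENNReal.ofReal_le_ofReal hst)

theorem measurable_decRearr (F : α → ℝ≥0∞) : Measurable (decRearr μ F) :=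
  (decRearr_antitone F).measurable

theorem decRearr_mono {F G : α → ℝ≥0∞} (h : F ≤ G) (t : ℝ) : decRearr μ F t ≤ decRearr μ G t :=
  sInf_le_sInf fun _ hu => (measure_mono fun _ hx => lt_of_lt_of_le hx (h _)).trans hu

theorem decRearr_le {F : α → ℝ≥0∞} {u : ℝ≥0∞} {t : ℝ}
    (h : μ {x | u < F x} ≤ ENNReal.ofReal t) : decRearr μ F t ≤ u :=
  sInf_le h

theorem measure_decRearr_lt_le (F : α → ℝ≥0∞) (t : ℝ) :
    μ {x | decRearr μ F t < F x} ≤ ENNReal.ofReal t := by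
  have hne : {s : ℝ≥0∞ | μ {x | s < F x} ≤ ENNReal.ofReal t}.Nonempty :=
    ⟨∞, by simp⟩
  obtain ⟨u, hu, -, hlim, hmem⟩ :=
    (isGLB_sInf {s : ℝ≥0∞ | μ {x | s < F x} ≤ ENNReal.ofReal t}).exists_seq_antitone_tendsto hne
  have hset : {x | decRearr μ F t < F x} = ⋃ k, {x | u k < F x} := by
    ext x
    simp only [mem_ofPred_eq, mem_iUnion]
    constructor
    · intro hx
      exact (hlim.eventually (gt_mem_nhds hx)).exists
    · rintro ⟨k, hk⟩
      exact lt_of_le_of_lt (sInf_le (hmem k)) hk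
  have hmono : Monotone fun k => {x | u k < F x} :=
    fun i j hij x hx => lt_of_le_of_lt (hu hij) hx
  rw [hset, hmono.measure_iUnion]
  exact iSup_le hmem

theorem lt_decRearr_iff {F : α → ℝ≥0∞} {u : ℝ≥0∞} {t : ℝ} :
    u < decRearr μ F t ↔ ENNReal.ofReal t < μ {x | u < F x} := by
  rw [← not_le, ← not_le, not_iff_not]
  refine ⟨fun h => ?_, decRearr_le⟩
  exact (measure_mono fun x hx => lt_of_le_of_lt h hx).trans (measure_decRearr_lt_le F t)

theorem volume_Ioi_inter_ofReal_lt_s6 (m : ℝ≥0∞) :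
    volume ({s : ℝ | ENNReal.ofReal s < m} ∩ Ioi 0) = m := by
  induction m with
  | top => simp
  | coe m =>
    have : {s : ℝ | ENNReal.ofReal s < m} ∩ Ioi 0 = Ioo 0 (m : ℝ) := by
      ext s
      simp only [mem_inter_iff, mem_ofPred_eq, mem_Ioi, mem_Ioo]
      rw [and_comm]
      refine and_congr_right fun hs => ?_
      rw [← ENNReal.ofReal_coe_nnreal, ENNReal.ofReal_lt_ofReal_iff_of_nonneg hs.le]
    rw [this]
    simp

/-- Layer-cake formula against a weight. -/
theorem lintegral_mul_eq_lintegral_superlevel [SFinite μ] {F G : α → ℝ≥0∞}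
    (hF : Measurable F) (hG : Measurable G) :
    ∫⁻ x, F x * G x ∂μ =
      ∫⁻ u in Ioi (0 : ℝ), ∫⁻ x in {x | ENNReal.ofReal u < F x}, G x ∂μ := by
  have hpt : ∀ x, F x * G x =
      ∫⁻ u in Ioi (0 : ℝ), {x | ENNReal.ofReal u < F x}.indicator G x := by
    intro x
    have : ∀ u : ℝ, {x | ENNReal.ofReal u < F x}.indicator G x =
        {u : ℝ | ENNReal.ofReal u < F x}.indicator (fun _ => G x) u := fun u => by
      simp [indicator]
    simp_rw [this]
    have hm : MeasurableSet {u : ℝ | ENNReal.ofReal u < F x} :=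
      measurableSet_lt ENNReal.measurable_ofReal measurable_const
    rw [lintegral_indicator_const hm, Measure.restrict_apply hm, volume_Ioi_inter_ofReal_lt_s6,
      mul_comm]
  simp_rw [hpt]
  rw [lintegral_lintegral_swap]
  · refine lintegral_congr fun u => ?_
    rw [lintegral_indicator (measurableSet_lt measurable_const hF)]
  · refine Measurable.aemeasurable ?_
    have hm : MeasurableSet {z : α × ℝ | ENNReal.ofReal z.2 < F z.1} :=
      measurableSet_lt (ENNReal.measurable_ofReal.comp measurable_snd) (hF.comp measurable_fst)
    exact (hG.comp measurable_fst).indicator hm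

/-- Hardy–Littlewood rearrangement inequality. -/
theorem lintegral_mul_le_lintegral_decRearr [SFinite μ] {F G : α → ℝ≥0∞}
    (hF : Measurable F) (hG : Measurable G) :
    ∫⁻ x, F x * G x ∂μ ≤ ∫⁻ s in Ioi (0 : ℝ), decRearr μ F s * decRearr μ G s := by
  rw [lintegral_mul_eq_lintegral_superlevel hF hG,
    lintegral_mul_eq_lintegral_superlevel (measurable_decRearr F) (measurable_decRearr G)]
  refine lintegral_mono fun u => ?_
  have e1 := lintegral_mul_eq_lintegral_superlevel
    (μ := μ.restrict {x | ENNReal.ofReal u < F x}) hG measurable_one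
  have e2 := lintegral_mul_eq_lintegral_superlevel
    (μ := (volume.restrict (Ioi (0 : ℝ))).restrict {s | ENNReal.ofReal u < decRearr μ F s})
    (measurable_decRearr (μ := μ) G) measurable_one
  simp only [Pi.one_apply, mul_one] at e1 e2
  rw [e1, e2]
  refine lintegral_mono fun v => ?_
  simp only [lintegral_const, one_mul, Measure.restrict_apply_univ]
  rw [Measure.restrict_apply (measurableSet_lt measurable_const hG),
    Measure.restrict_apply (measurableSet_lt measurable_const (measurable_decRearr G)),
    Measure.restrict_apply ((measurableSet_lt measurable_const (measurable_decRearr G)).inter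
      (measurableSet_lt measurable_const (measurable_decRearr F)))]
  simp only [lt_decRearr_iff]
  have : ({s : ℝ | ENNReal.ofReal s < μ {x | ENNReal.ofReal v < G x}} ∩
      {s : ℝ | ENNReal.ofReal s < μ {x | ENNReal.ofReal u < F x}}) =
      {s : ℝ | ENNReal.ofReal s <
        min (μ {x | ENNReal.ofReal v < G x}) (μ {x | ENNReal.ofReal u < F x})} := by
    ext s
    simp
  rw [this, volume_Ioi_inter_ofReal_lt_s6]
  exact le_min (measure_mono inter_subset_left) (measure_mono inter_subset_right)

theorem setLIntegral_le_lintegral_decRearr [SFinite μ] {F : α → ℝ≥0∞} (hF : Measurable F)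
    {E : Set α} (hE : MeasurableSet E) {t : ℝ} (hEt : μ E ≤ ENNReal.ofReal t) :
    ∫⁻ x in E, F x ∂μ ≤ ∫⁻ s in Ioc 0 t, decRearr μ F s := by
  have h := lintegral_mul_le_lintegral_decRearr (μ := μ) hF
    ((measurable_one (α := ℝ≥0∞) (β := α)).indicator hE)
  have e : ∀ x, F x * E.indicator 1 x = E.indicator F x := fun x => by
    by_cases hx : x ∈ E <;> simp [hx]
  simp_rw [e] at h
  rw [lintegral_indicator hE] at h
  refine h.trans ?_
  rw [← Ioi_inter_Iic, inter_comm, ← Measure.restrict_restrict measurableSet_Iic,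
    ← lintegral_indicator measurableSet_Iic]
  refine lintegral_mono fun s => ?_
  by_cases hs : s ≤ t
  · rw [indicator_of_mem (by exact hs)]
    refine mul_le_of_le_one_right' (decRearr_le ?_)
    have : {x | (1 : ℝ≥0∞) < E.indicator 1 x} = ∅ := by
      ext x
      by_cases hx : x ∈ E <;> simp [hx]
    simp [this]
  · have : decRearr μ (E.indicator 1) s = 0 := by
      refine le_antisymm (decRearr_le ?_) zero_le
      have : {x | (0 : ℝ≥0∞) < E.indicator 1 x} = E := by
        ext x
        by_cases hx : x ∈ E <;> simp [hx]
      rw [this]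
      exact hEt.trans (ENNReal.ofReal_le_ofReal (not_le.1 hs).le)
    simp [this]

theorem ofReal_mul_decRearr_le (F : α → ℝ≥0∞) (t : ℝ) :
    ENNReal.ofReal t * decRearr μ F t ≤ ∫⁻ s in Ioc 0 t, decRearr μ F s := by
  calc ENNReal.ofReal t * decRearr μ F t = ∫⁻ _ in Ioc 0 t, decRearr μ F t := by
        simp [mul_comm]
    _ ≤ _ := setLIntegral_mono (measurable_decRearr F) fun s hs => decRearr_antitone F hs.2

theorem decRearr_comp {β : Type*} [MeasurableSpace β] {ν : Measure β} {φ : α → β}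
    (hφ : MeasurePreserving φ μ ν) {F : β → ℝ≥0∞} (hF : Measurable F) (t : ℝ) :
    decRearr μ (fun x => F (φ x)) t = decRearr ν F t := by
  unfold decRearr
  congr 1
  ext s
  simp only [mem_ofPred_eq]
  rw [← hφ.measure_preimage (measurableSet_lt measurable_const hF).nullMeasurableSet]
  rfl

theorem decRearr_le_of_le_add {H K : α → ℝ≥0∞} (hK : Measurable K) {t : ℝ}
    (ht : 0 < t) {P D : ℝ≥0∞} (hKP : ∫⁻ x, K x ∂μ ≤ P) (hHK : ∀ x, H x ≤ K x + D) :
    decRearr μ H t ≤ P / ENNReal.ofReal t + D := by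
  have ht0 : ENNReal.ofReal t ≠ 0 := by simpa using ht
  refine decRearr_le ?_
  have hsub : {x | P / ENNReal.ofReal t + D < H x} ⊆ {x | P / ENNReal.ofReal t < K x} := by
    intro x hx
    by_contra hcon
    exact absurd ((hHK x).trans (add_le_add_left (not_lt.1 hcon) D)) (not_le.2 hx)
  refine (measure_mono hsub).trans ?_
  rcases eq_or_ne P 0 with rfl | hP0
  · have h0 : K =ᵐ[μ] 0 := (lintegral_eq_zero_iff hK).1 (le_antisymm hKP zero_le)
    have : μ {x | 0 / ENNReal.ofReal t < K x} = 0 := by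
      simp only [ENNReal.zero_div]
      refine measure_mono_null (fun x hx => ?_) (ae_iff.1 h0)
      exact (ne_of_gt hx)
    rw [this]
    exact zero_le
  rcases eq_or_ne P ∞ with rfl | hPt
  · simp [ENNReal.top_div]
  have hne0 : P / ENNReal.ofReal t ≠ 0 := by simp [ENNReal.div_eq_zero_iff, hP0]
  have hnet : P / ENNReal.ofReal t ≠ ∞ := ENNReal.div_ne_top hPt ht0
  refine (measure_mono fun x (hx : _ < K x) => hx.le).trans
    ((meas_ge_le_lintegral_div hK.aemeasurable hne0 hnet).trans ?_)
  refine (ENNReal.div_le_div_right hKP _).trans (le_of_eq ?_)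
  rw [ENNReal.div_div_cancel hP0 hPt]

end Rearrangement

section Convolution

variable {X : Type*} [MeasurableSpace X] [AddGroup X] [MeasurableAdd₂ X] [MeasurableNeg X]
  {μ : Measure X} [SFinite μ]

theorem measurable_lintegral_sub_mul {F G : X → ℝ≥0∞} (hF : Measurable F) (hG : Measurable G) :
    Measurable fun x => ∫⁻ y, F (x - y) * G y ∂μ :=
  Measurable.lintegral_prod_right'
    (f := fun z : X × X => F (z.1 - z.2) * G z.2)
    ((hF.comp (measurable_fst.sub measurable_snd)).mul (hG.comp measurable_snd))

theorem lintegral_lintegral_sub_mul [μ.IsAddRightInvariant] {F G : X → ℝ≥0∞}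
    (hF : Measurable F) (hG : Measurable G) :
    ∫⁻ x, ∫⁻ y, F (x - y) * G y ∂μ ∂μ = (∫⁻ x, F x ∂μ) * ∫⁻ y, G y ∂μ := by
  rw [lintegral_lintegral_swap
    (((hF.comp (measurable_fst.sub measurable_snd)).mul (hG.comp measurable_snd)).aemeasurable)]
  have : ∀ y, ∫⁻ x, F (x - y) * G y ∂μ = (∫⁻ x, F x ∂μ) * G y := fun y => by
    have hm : Measurable fun x => F (x - y) := hF.comp (measurable_id.sub_const y)
    rw [lintegral_mul_const _ hm,
      lintegral_sub_right_eq_self F y]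
  simp_rw [this]
  rw [lintegral_const_mul _ hG]

theorem mul_le_mul_truncations (a b u v u₁ v₁ : ℝ≥0∞) (hu : u ≤ u₁ + min u a)
    (hv : v ≤ v₁ + min v b) :
    u * v ≤ u₁ * v₁ + (u₁ * b + a * v₁ + min u a * min v b) := by
  calc u * v ≤ (u₁ + min u a) * (v₁ + min v b) := mul_le_mul' hu hv
    _ = u₁ * v₁ + (u₁ * min v b + min u a * v₁ + min u a * min v b) := by ring
    _ ≤ _ := by
      gcongr
      · exact min_le_right _ _
      · exact min_le_right _ _

/-- Pointwise estimate for the decreasing rearrangement of a convolution. -/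
theorem decRearr_lintegral_sub_mul_le [μ.IsAddLeftInvariant] [μ.IsAddRightInvariant]
    [μ.IsNegInvariant] {F G : X → ℝ≥0∞} (hF : Measurable F) (hG : Measurable G)
    {t : ℝ} (ht : 0 < t) :
    decRearr μ (fun x => ∫⁻ y, F (x - y) * G y ∂μ) t ≤
      4 * ((∫⁻ s in Ioc 0 t, decRearr μ F s) * (∫⁻ s in Ioc 0 t, decRearr μ G s) /
        ENNReal.ofReal t) + ∫⁻ s in Ioi t, decRearr μ F s * decRearr μ G s := by
  have ht0 : ENNReal.ofReal t ≠ 0 := by simpa using ht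
  set A := ∫⁻ s in Ioc 0 t, decRearr μ F s
  set B := ∫⁻ s in Ioc 0 t, decRearr μ G s
  set a := decRearr μ F t
  set b := decRearr μ G t
  have ha : a ≤ A / ENNReal.ofReal t := by
    rw [ENNReal.le_div_iff_mul_le (Or.inl ht0) (Or.inl ENNReal.ofReal_ne_top), mul_comm]
    exact ofReal_mul_decRearr_le F t
  have hb : b ≤ B / ENNReal.ofReal t := by
    rw [ENNReal.le_div_iff_mul_le (Or.inl ht0) (Or.inl ENNReal.ofReal_ne_top), mul_comm]
    exact ofReal_mul_decRearr_le G t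
  have hEF : MeasurableSet {x | a < F x} := measurableSet_lt measurable_const hF
  have hEG : MeasurableSet {x | b < G x} := measurableSet_lt measurable_const hG
  set F₁ := {x | a < F x}.indicator F with hF₁
  set G₁ := {x | b < G x}.indicator G with hG₁
  have hF₁m : Measurable F₁ := hF.indicator hEF
  have hG₁m : Measurable G₁ := hG.indicator hEG
  have hF₁A : ∫⁻ x, F₁ x ∂μ ≤ A := by
    rw [lintegral_indicator hEF]
    exact setLIntegral_le_lintegral_decRearr hF hEF (measure_decRearr_lt_le F t)
  have hG₁B : ∫⁻ x, G₁ x ∂μ ≤ B := by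
    rw [lintegral_indicator hEG]
    exact setLIntegral_le_lintegral_decRearr hG hEG (measure_decRearr_lt_le G t)
  have hFle : ∀ x, F x ≤ F₁ x + min (F x) a := fun x => by
    by_cases hx : a < F x
    · simp [hF₁, hx]
    · simp [not_lt.1 hx]
  have hGle : ∀ x, G x ≤ G₁ x + min (G x) b := fun x => by
    by_cases hx : b < G x
    · simp [hG₁, hx]
    · simp [not_lt.1 hx]
  have htail : ∀ x, ∫⁻ y, min (F (x - y)) a * min (G y) b ∂μ ≤
      A * B / ENNReal.ofReal t + ∫⁻ s in Ioi t, decRearr μ F s * decRearr μ G s := by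
    intro x
    have hFa : Measurable fun y => min (F y) a := hF.min measurable_const
    have hmp := μ.measurePreserving_sub_left x
    refine (lintegral_mul_le_lintegral_decRearr (hFa.comp hmp.measurable)
      (hG.min measurable_const)).trans ?_
    rw [← Ioc_union_Ioi_eq_Ioi ht.le,
      lintegral_union measurableSet_Ioi (Ioc_disjoint_Ioi le_rfl)]
    refine add_le_add ?_ (lintegral_mono fun s => mul_le_mul' ?_ ?_)
    · calc _ ≤ ∫⁻ _ in Ioc 0 t, a * b := by
            refine lintegral_mono fun s => mul_le_mul' (decRearr_le ?_) (decRearr_le ?_) <;> simp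
        _ = (a * ENNReal.ofReal t) * b := by simp; ring
        _ ≤ A * (B / ENNReal.ofReal t) := by
            refine mul_le_mul' ?_ hb
            rw [mul_comm]
            exact ofReal_mul_decRearr_le F t
        _ = _ := by rw [mul_div_assoc]
    · rw [← decRearr_comp hmp hF]
      exact decRearr_mono (fun y => min_le_left _ _) s
    · exact decRearr_mono (fun y => min_le_left _ _) s
  have key := decRearr_le_of_le_add (μ := μ) (H := fun x => ∫⁻ y, F (x - y) * G y ∂μ)
    (measurable_lintegral_sub_mul hF₁m hG₁m) ht
    (P := A * B) (D := A * b + a * B + (A * B / ENNReal.ofReal t +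
      ∫⁻ s in Ioi t, decRearr μ F s * decRearr μ G s))
    ((lintegral_lintegral_sub_mul hF₁m hG₁m).le.trans (mul_le_mul' hF₁A hG₁B)) (fun x => by
      have hm := (μ.measurePreserving_sub_left x).measurable
      have m1 : Measurable fun y => F₁ (x - y) := hF₁m.comp hm
      calc ∫⁻ y, F (x - y) * G y ∂μ
          ≤ ∫⁻ y, F₁ (x - y) * G₁ y + (F₁ (x - y) * b + a * G₁ y +
              min (F (x - y)) a * min (G y) b) ∂μ :=
            lintegral_mono fun y => mul_le_mul_truncations a b _ _ _ _ (hFle _) (hGle _)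
        _ = ∫⁻ y, F₁ (x - y) * G₁ y ∂μ + ((∫⁻ y, F₁ (x - y) ∂μ) * b + a * ∫⁻ y, G₁ y ∂μ +
              ∫⁻ y, min (F (x - y)) a * min (G y) b ∂μ) := by
            rw [lintegral_add_left (m1.fun_mul hG₁m),
              lintegral_add_left ((m1.mul_const b).fun_add (hG₁m.const_mul a)),
              lintegral_add_left (m1.mul_const b), lintegral_mul_const _ m1,
              lintegral_const_mul _ hG₁m]
        _ ≤ _ := by
            rw [lintegral_sub_left_eq_self F₁ x]
            gcongr
            exact htail x)
  refine key.trans ?_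
  calc _ ≤ A * B / ENNReal.ofReal t + (A * (B / ENNReal.ofReal t) + A / ENNReal.ofReal t * B +
        (A * B / ENNReal.ofReal t + ∫⁻ s in Ioi t, decRearr μ F s * decRearr μ G s)) := by
        gcongr
    _ = _ := by
        simp only [div_eq_mul_inv]
        ring

end Convolution

section LogNorm

/-- The measure `dt / t` on `(0, ∞)`. -/
noncomputable def logMeasure : Measure ℝ :=
  (volume.restrict (Ioi (0 : ℝ))).withDensity fun t => ENNReal.ofReal t⁻¹

instance : SFinite logMeasure := by
  unfold logMeasure
  infer_instance

theorem ae_logMeasure_pos : ∀ᵐ t ∂logMeasure, 0 < t :=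
  (withDensity_absolutelyContinuous _ _).ae_le (ae_restrict_mem measurableSet_Ioi)

theorem lintegral_logMeasure {φ : ℝ → ℝ≥0∞} (hφ : Measurable φ) :
    ∫⁻ t, φ t ∂logMeasure = ∫⁻ t in Ioi (0 : ℝ), ENNReal.ofReal t⁻¹ * φ t :=
  lintegral_withDensity_eq_lintegral_mul _ (ENNReal.measurable_ofReal.comp measurable_inv) hφ

/-- The `L^q(dt / t)` norm on `(0, ∞)`, with a genuine supremum for `q = ∞`. -/
noncomputable def logNorm (q : ℝ≥0∞) (φ : ℝ → ℝ≥0∞) : ℝ≥0∞ :=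
  if q = ∞ then ⨆ t ∈ Ioi (0 : ℝ), φ t
  else (∫⁻ t, φ t ^ q.toReal ∂logMeasure) ^ q.toReal⁻¹

theorem logNorm_top (φ : ℝ → ℝ≥0∞) : logNorm ∞ φ = ⨆ t ∈ Ioi (0 : ℝ), φ t := if_pos rfl

theorem logNorm_of_ne_top {q : ℝ≥0∞} (hq : q ≠ ∞) (φ : ℝ → ℝ≥0∞) :
    logNorm q φ = (∫⁻ t, φ t ^ q.toReal ∂logMeasure) ^ q.toReal⁻¹ := if_neg hq

theorem le_logNorm_top (φ : ℝ → ℝ≥0∞) {t : ℝ} (ht : 0 < t) : φ t ≤ logNorm ∞ φ := by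
  rw [logNorm_top]
  exact le_iSup₂ (f := fun (t : ℝ) (_ : t ∈ Ioi (0 : ℝ)) => φ t) t ht

theorem logNorm_top_le {φ : ℝ → ℝ≥0∞} {c : ℝ≥0∞} (h : ∀ t, 0 < t → φ t ≤ c) :
    logNorm ∞ φ ≤ c := by
  rw [logNorm_top]
  exact iSup₂_le h

theorem one_le_toReal {q : ℝ≥0∞} (hq : 1 ≤ q) (hq' : q ≠ ∞) : 1 ≤ q.toReal := by
  simpa using ENNReal.toReal_mono hq' hq

theorem logNorm_mono (q : ℝ≥0∞) {φ ψ : ℝ → ℝ≥0∞} (h : ∀ t, 0 < t → φ t ≤ ψ t) :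
    logNorm q φ ≤ logNorm q ψ := by
  rcases eq_or_ne q ∞ with rfl | hq
  · exact logNorm_top_le fun t ht => (h t ht).trans (le_logNorm_top ψ ht)
  · rw [logNorm_of_ne_top hq, logNorm_of_ne_top hq]
    refine ENNReal.rpow_le_rpow (lintegral_mono_ae ?_) (by positivity)
    filter_upwards [ae_logMeasure_pos] with t ht
    exact ENNReal.rpow_le_rpow (h t ht) (by positivity)

theorem logNorm_add_le {q : ℝ≥0∞} (hq : 1 ≤ q) {φ ψ : ℝ → ℝ≥0∞} (hφ : Measurable φ)
    (hψ : Measurable ψ) :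
    logNorm q (fun t => φ t + ψ t) ≤ logNorm q φ + logNorm q ψ := by
  rcases eq_or_ne q ∞ with rfl | hq'
  · exact logNorm_top_le fun t ht => add_le_add (le_logNorm_top φ ht) (le_logNorm_top ψ ht)
  · simp only [logNorm_of_ne_top hq']
    simpa using ENNReal.lintegral_Lp_add_le hφ.aemeasurable hψ.aemeasurable (one_le_toReal hq hq')

theorem logNorm_const_mul_le {q : ℝ≥0∞} (hq : 1 ≤ q) (c : ℝ≥0∞) {φ : ℝ → ℝ≥0∞}
    (hφ : Measurable φ) : logNorm q (fun t => c * φ t) ≤ c * logNorm q φ := by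
  rcases eq_or_ne q ∞ with rfl | hq'
  · exact logNorm_top_le fun t ht => mul_le_mul' le_rfl (le_logNorm_top φ ht)
  · have hq1 := one_le_toReal hq hq'
    have hq0 : 0 ≤ q.toReal := by positivity
    simp only [logNorm_of_ne_top hq', ENNReal.mul_rpow_of_nonneg _ _ hq0]
    rw [lintegral_const_mul _ (hφ.pow_const _), ENNReal.mul_rpow_of_nonneg _ _ (by positivity),
      ENNReal.rpow_rpow_inv (by positivity)]

theorem logNorm_mul_le {q q₁ q₂ : ℝ≥0∞} (hq : 1 ≤ q) (hq₁ : 1 ≤ q₁) (hq₂ : 1 ≤ q₂)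
    (hqc : q₂⁻¹ = q⁻¹ + q₁⁻¹) {φ ψ : ℝ → ℝ≥0∞} (hφ : Measurable φ) (hψ : Measurable ψ) :
    logNorm q₂ (fun t => φ t * ψ t) ≤ logNorm q φ * logNorm q₁ ψ := by
  rcases eq_or_ne q ∞ with rfl | hq'
  · obtain rfl : q₂ = q₁ := by simpa using hqc
    exact (logNorm_mono _ fun t ht => mul_le_mul' (le_logNorm_top φ ht) le_rfl).trans
      (logNorm_const_mul_le hq₁ _ hψ)
  rcases eq_or_ne q₁ ∞ with rfl | hq₁'
  · obtain rfl : q₂ = q := by simpa using hqc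
    rw [mul_comm]
    refine (logNorm_mono _ fun t ht => ?_).trans (logNorm_const_mul_le hq _ hφ)
    rw [mul_comm]
    exact mul_le_mul' (le_logNorm_top ψ ht) le_rfl
  have hq₂' : q₂ ≠ ∞ := by
    rintro rfl
    have : q⁻¹ = 0 ∧ q₁⁻¹ = 0 := by simpa using hqc.symm
    exact hq' (by simpa using this.1)
  have h1 := one_le_toReal hq hq'
  have h2 := one_le_toReal hq₁ hq₁'
  have h3 := one_le_toReal hq₂ hq₂'
  have hreal : 1 / q₂.toReal = 1 / q.toReal + 1 / q₁.toReal := by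
    have := congrArg ENNReal.toReal hqc
    rw [ENNReal.toReal_add (by simpa using (zero_lt_one.trans_le hq).ne')
      (by simpa using (zero_lt_one.trans_le hq₁).ne')] at this
    simpa using this
  have hlt : q₂.toReal < q.toReal := by
    rw [← one_div_lt_one_div (by positivity) (by positivity), hreal]
    have : 0 < 1 / q₁.toReal := by positivity
    linarith
  simp only [logNorm_of_ne_top hq', logNorm_of_ne_top hq₁', logNorm_of_ne_top hq₂']
  simpa using ENNReal.lintegral_Lp_mul_le_Lq_mul_Lr (by positivity) hlt hreal logMeasure
    hφ.aemeasurable hψ.aemeasurable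

theorem lintegral_mul_rpow_le {α : Type*} [MeasurableSpace α] {μ : Measure α} {k φ : α → ℝ≥0∞}
    (hk : Measurable k) (hφ : Measurable φ) {r : ℝ} (hr : 1 ≤ r) :
    (∫⁻ s, k s * φ s ∂μ) ^ r ≤ (∫⁻ s, k s ∂μ) ^ (r - 1) * ∫⁻ s, k s * φ s ^ r ∂μ := by
  have hr0 : 0 < r := by positivity
  have hinv : r⁻¹ ≤ 1 := inv_le_one_of_one_le₀ hr
  have h := ENNReal.lintegral_mul_norm_pow_le (μ := μ) hk.aemeasurable
    (hk.mul (hφ.pow_const r)).aemeasurable (sub_nonneg.2 hinv) (by positivity : 0 ≤ r⁻¹) (by ring)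
  have e : ∀ s, k s ^ (1 - r⁻¹) * (k * fun s => φ s ^ r) s ^ r⁻¹ = k s * φ s := fun s => by
    rw [Pi.mul_apply, ENNReal.mul_rpow_of_nonneg _ _ (by positivity), ← mul_assoc,
      ← ENNReal.rpow_add_of_nonneg _ _ (sub_nonneg.2 hinv) (by positivity),
      ENNReal.rpow_rpow_inv hr0.ne']
    simp
  simp_rw [e] at h
  refine (ENNReal.rpow_le_rpow h hr0.le).trans (le_of_eq ?_)
  rw [ENNReal.mul_rpow_of_nonneg _ _ hr0.le, ← ENNReal.rpow_mul, ENNReal.rpow_inv_rpow hr0.ne']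
  congr 2
  field_simp

/-- Schur test for `logNorm`. -/
theorem logNorm_lintegral_le {q : ℝ≥0∞} (hq : 1 ≤ q) {k : ℝ → ℝ → ℝ≥0∞}
    (hk : Measurable (Function.uncurry k)) {C : ℝ≥0∞}
    (hrow : ∀ t, 0 < t → ∫⁻ s, k t s ∂logMeasure ≤ C)
    (hcol : ∀ s, 0 < s → ∫⁻ t, k t s ∂logMeasure ≤ C) {φ : ℝ → ℝ≥0∞} (hφ : Measurable φ) :
    logNorm q (fun t => ∫⁻ s, k t s * φ s ∂logMeasure) ≤ C * logNorm q φ := by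
  rcases eq_or_ne q ∞ with rfl | hq'
  · refine logNorm_top_le fun t ht => ?_
    calc ∫⁻ s, k t s * φ s ∂logMeasure ≤ ∫⁻ s, k t s * logNorm ∞ φ ∂logMeasure := by
          refine lintegral_mono_ae ?_
          filter_upwards [ae_logMeasure_pos] with s hs
          exact mul_le_mul' le_rfl (le_logNorm_top φ hs)
      _ = (∫⁻ s, k t s ∂logMeasure) * logNorm ∞ φ := lintegral_mul_const _ hk.of_uncurry_left
      _ ≤ _ := mul_le_mul' (hrow t ht) le_rfl
  have hr := one_le_toReal hq hq'
  simp only [logNorm_of_ne_top hq']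
  set r := q.toReal
  have hr0 : 0 < r := by positivity
  have hφr : Measurable fun s => φ s ^ r := hφ.pow_const r
  have hmain : ∫⁻ t, (∫⁻ s, k t s * φ s ∂logMeasure) ^ r ∂logMeasure ≤
      C ^ r * ∫⁻ s, φ s ^ r ∂logMeasure := by
    calc _ ≤ ∫⁻ t, C ^ (r - 1) * ∫⁻ s, k t s * φ s ^ r ∂logMeasure ∂logMeasure := by
          refine lintegral_mono_ae ?_
          filter_upwards [ae_logMeasure_pos] with t ht
          refine (lintegral_mul_rpow_le hk.of_uncurry_left hφ hr).trans ?_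
          exact mul_le_mul' (ENNReal.rpow_le_rpow (hrow t ht) (by linarith)) le_rfl
      _ = C ^ (r - 1) * ∫⁻ t, ∫⁻ s, k t s * φ s ^ r ∂logMeasure ∂logMeasure := by
          rw [lintegral_const_mul]
          exact Measurable.lintegral_prod_right'
            (f := fun z : ℝ × ℝ => k z.1 z.2 * φ z.2 ^ r) (hk.mul (hφr.comp measurable_snd))
      _ = C ^ (r - 1) * ∫⁻ s, (∫⁻ t, k t s ∂logMeasure) * φ s ^ r ∂logMeasure := by
          rw [lintegral_lintegral_swap (hk.mul (hφr.comp measurable_snd)).aemeasurable]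
          congr 1
          refine lintegral_congr fun s => ?_
          rw [lintegral_mul_const _ hk.of_uncurry_right]
      _ ≤ C ^ (r - 1) * ∫⁻ s, C * φ s ^ r ∂logMeasure := by
          refine mul_le_mul' le_rfl ?_
          refine lintegral_mono_ae ?_
          filter_upwards [ae_logMeasure_pos] with s hs
          exact mul_le_mul' (hcol s hs) le_rfl
      _ = C ^ r * ∫⁻ s, φ s ^ r ∂logMeasure := by
          rw [lintegral_const_mul _ hφr, ← mul_assoc]
          congr 1
          nth_rewrite 2 [← ENNReal.rpow_one C]
          rw [← ENNReal.rpow_add_of_nonneg _ _ (by linarith) zero_le_one]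
          simp
  refine (ENNReal.rpow_le_rpow hmain (by positivity)).trans (le_of_eq ?_)
  rw [ENNReal.mul_rpow_of_nonneg _ _ (by positivity), ENNReal.rpow_rpow_inv hr0.ne']

end LogNorm

section Hardy

/-- The kernel `(s / t) ^ γ` on `s ≤ t`, whose integral operators on `L^q(dt / t)` are
the Hardy operators. -/
noncomputable def hardyKernel (γ t s : ℝ) : ℝ≥0∞ :=
  {z : ℝ × ℝ | z.2 ≤ z.1}.indicator (fun z => ENNReal.ofReal ((z.2 / z.1) ^ γ)) (t, s)

theorem hardyKernel_of_le {γ t s : ℝ} (h : s ≤ t) :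
    hardyKernel γ t s = ENNReal.ofReal ((s / t) ^ γ) :=
  indicator_of_mem (s := {z : ℝ × ℝ | z.2 ≤ z.1}) h _

theorem hardyKernel_of_lt {γ t s : ℝ} (h : t < s) : hardyKernel γ t s = 0 :=
  indicator_of_notMem (s := {z : ℝ × ℝ | z.2 ≤ z.1}) (not_le.2 h) _

theorem measurable_hardyKernel (γ : ℝ) : Measurable (Function.uncurry (hardyKernel γ)) :=
  Measurable.indicator
    (ENNReal.measurable_ofReal.comp ((measurable_snd.div measurable_fst).pow_const γ))
    (measurableSet_le measurable_snd measurable_fst)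

theorem lintegral_hardyKernel_mul (γ t : ℝ) {φ : ℝ → ℝ≥0∞} (hφ : Measurable φ) :
    ∫⁻ s, hardyKernel γ t s * φ s ∂logMeasure =
      ∫⁻ s in Ioc 0 t, ENNReal.ofReal s⁻¹ * (ENNReal.ofReal ((s / t) ^ γ) * φ s) := by
  rw [lintegral_logMeasure ((measurable_hardyKernel γ).of_uncurry_left.fun_mul hφ),
    ← Ioi_inter_Iic, inter_comm, ← Measure.restrict_restrict measurableSet_Iic,
    ← lintegral_indicator measurableSet_Iic]
  refine lintegral_congr fun s => ?_
  rcases le_or_gt s t with h | h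
  · rw [indicator_of_mem (by exact h), hardyKernel_of_le h]
  · rw [indicator_of_notMem (by exact not_le.2 h), hardyKernel_of_lt h]
    simp

theorem lintegral_hardyKernel_swap_mul (γ : ℝ) {t : ℝ} (ht : 0 < t) {φ : ℝ → ℝ≥0∞}
    (hφ : Measurable φ) :
    ∫⁻ s, hardyKernel γ s t * φ s ∂logMeasure =
      ∫⁻ s in Ioi t, ENNReal.ofReal s⁻¹ * (ENNReal.ofReal ((t / s) ^ γ) * φ s) := by
  have hset : Ici t = Ici t ∩ Ioi 0 :=
    (inter_eq_left.2 fun s hs => lt_of_lt_of_le ht hs).symm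
  rw [lintegral_logMeasure ((measurable_hardyKernel γ).of_uncurry_right.fun_mul hφ),
    setLIntegral_congr (Ioi_ae_eq_Ici (a := t)), hset,
    ← Measure.restrict_restrict measurableSet_Ici, ← lintegral_indicator measurableSet_Ici]
  refine lintegral_congr fun s => ?_
  rcases le_or_gt t s with h | h
  · rw [indicator_of_mem (by exact h), hardyKernel_of_le h]
  · rw [indicator_of_notMem (by exact not_le.2 h), hardyKernel_of_lt h]
    simp

theorem lintegral_hardyKernel {γ t : ℝ} (hγ : 0 < γ) (ht : 0 < t) :
    ∫⁻ s, hardyKernel γ t s ∂logMeasure ≤ ENNReal.ofReal γ⁻¹ := by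
  have h := lintegral_hardyKernel_mul γ t (measurable_one (α := ℝ≥0∞) (β := ℝ))
  simp only [Pi.one_apply, mul_one] at h
  have hint : IntegrableOn (fun s : ℝ => t ^ (-γ) * s ^ (γ - 1)) (Ioc 0 t) :=
    ((intervalIntegrable_iff_integrableOn_Ioc_of_le ht.le).1
      (intervalIntegral.intervalIntegrable_rpow' (by linarith))).const_mul _
  have e : ∀ s ∈ Ioc 0 t, ENNReal.ofReal s⁻¹ * ENNReal.ofReal ((s / t) ^ γ) =
      ENNReal.ofReal (t ^ (-γ) * s ^ (γ - 1)) := fun s hs => by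
    have hs0 : 0 < s := hs.1
    rw [← ENNReal.ofReal_mul (by positivity), Real.div_rpow hs0.le ht.le,
      Real.rpow_neg ht.le, Real.rpow_sub_one hs0.ne']
    congr 1
    field_simp
  rw [h, setLIntegral_congr_fun measurableSet_Ioc e, ← ofReal_integral_eq_lintegral_ofReal hint]
  · refine ENNReal.ofReal_le_ofReal (le_of_eq ?_)
    rw [integral_const_mul, ← intervalIntegral.integral_of_le ht.le,
      integral_rpow (Or.inl (by linarith))]
    simp only [sub_add_cancel, Real.zero_rpow hγ.ne', sub_zero]
    rw [Real.rpow_neg ht.le]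
    have : 0 < t ^ γ := by positivity
    field_simp
  · filter_upwards [ae_restrict_mem measurableSet_Ioc] with s hs
    have hs0 : 0 < s := hs.1
    simp only [Pi.zero_apply]
    positivity

theorem lintegral_hardyKernel_swap {γ t : ℝ} (hγ : 0 < γ) (ht : 0 < t) :
    ∫⁻ s, hardyKernel γ s t ∂logMeasure ≤ ENNReal.ofReal γ⁻¹ := by
  have h := lintegral_hardyKernel_swap_mul γ ht (measurable_one (α := ℝ≥0∞) (β := ℝ))
  simp only [Pi.one_apply, mul_one] at h
  have hint : IntegrableOn (fun s : ℝ => t ^ γ * s ^ (-γ - 1)) (Ioi t) :=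
    (integrableOn_Ioi_rpow_of_lt (by linarith) ht).const_mul _
  have e : ∀ s ∈ Ioi t, ENNReal.ofReal s⁻¹ * ENNReal.ofReal ((t / s) ^ γ) =
      ENNReal.ofReal (t ^ γ * s ^ (-γ - 1)) := fun s hs => by
    have hs0 : 0 < s := ht.trans hs
    rw [← ENNReal.ofReal_mul (by positivity), Real.div_rpow ht.le hs0.le,
      Real.rpow_sub_one hs0.ne', Real.rpow_neg hs0.le]
    congr 1
    field_simp
  rw [h, setLIntegral_congr_fun measurableSet_Ioi e, ← ofReal_integral_eq_lintegral_ofReal hint]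
  · refine ENNReal.ofReal_le_ofReal (le_of_eq ?_)
    rw [integral_const_mul, integral_Ioi_rpow_of_lt (by linarith) ht]
    simp only [sub_add_cancel]
    rw [Real.rpow_neg ht.le]
    have : 0 < t ^ γ := by positivity
    field_simp
  · filter_upwards [ae_restrict_mem measurableSet_Ioi] with s hs
    have hs0 : 0 < s := ht.trans hs
    simp only [Pi.zero_apply]
    positivity

theorem ofReal_rpow_mul_average_eq (β : ℝ) {t : ℝ} (ht : 0 < t) {φ : ℝ → ℝ≥0∞}
    (hφ : Measurable φ) :
    ENNReal.ofReal (t ^ β) * ((∫⁻ s in Ioc 0 t, φ s) / ENNReal.ofReal t) =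
      ∫⁻ s, hardyKernel (1 - β) t s * (ENNReal.ofReal (s ^ β) * φ s) ∂logMeasure := by
  have hm : Measurable fun s : ℝ => ENNReal.ofReal (s ^ β) :=
    ENNReal.measurable_ofReal.comp (measurable_id.pow_const β)
  have e : ∀ s ∈ Ioc 0 t, ENNReal.ofReal s⁻¹ * (ENNReal.ofReal ((s / t) ^ (1 - β)) *
      (ENNReal.ofReal (s ^ β) * φ s)) = ENNReal.ofReal (t ^ β * t⁻¹) * φ s := fun s hs => by
    have hs0 : 0 < s := hs.1
    rw [← mul_assoc, ← mul_assoc, ← ENNReal.ofReal_mul (by positivity),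
      ← ENNReal.ofReal_mul (by positivity), Real.div_rpow hs0.le ht.le,
      Real.rpow_sub hs0, Real.rpow_sub ht, Real.rpow_one, Real.rpow_one]
    congr 2
    have : 0 < t ^ β := by positivity
    have : 0 < s ^ β := by positivity
    field_simp
  rw [lintegral_hardyKernel_mul _ _ (hm.fun_mul hφ), setLIntegral_congr_fun measurableSet_Ioc e,
    lintegral_const_mul _ hφ, ENNReal.ofReal_mul (by positivity), ENNReal.ofReal_inv_of_pos ht,
    div_eq_mul_inv]
  ring

theorem ofReal_rpow_mul_tail_eq (γ : ℝ) {t : ℝ} (ht : 0 < t) {φ : ℝ → ℝ≥0∞}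
    (hφ : Measurable φ) :
    ENNReal.ofReal (t ^ γ) * ∫⁻ s in Ioi t, φ s =
      ∫⁻ s, hardyKernel γ s t * (ENNReal.ofReal (s ^ (γ + 1)) * φ s) ∂logMeasure := by
  have hm : Measurable fun s : ℝ => ENNReal.ofReal (s ^ (γ + 1)) :=
    ENNReal.measurable_ofReal.comp (measurable_id.pow_const _)
  have e : ∀ s ∈ Ioi t, ENNReal.ofReal s⁻¹ * (ENNReal.ofReal ((t / s) ^ γ) *
      (ENNReal.ofReal (s ^ (γ + 1)) * φ s)) = ENNReal.ofReal (t ^ γ) * φ s := fun s hs => by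
    have hs0 : 0 < s := ht.trans hs
    rw [← mul_assoc, ← mul_assoc, ← ENNReal.ofReal_mul (by positivity),
      ← ENNReal.ofReal_mul (by positivity), Real.div_rpow ht.le hs0.le, Real.rpow_add_one hs0.ne']
    congr 2
    have : 0 < s ^ γ := by positivity
    field_simp
  rw [lintegral_hardyKernel_swap_mul _ ht (hm.fun_mul hφ),
    setLIntegral_congr_fun measurableSet_Ioi e, lintegral_const_mul _ hφ]

theorem measurable_lintegral_kernel_mul {k : ℝ → ℝ → ℝ≥0∞} (hk : Measurable (Function.uncurry k))
    {φ : ℝ → ℝ≥0∞} (hφ : Measurable φ) :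
    Measurable fun t => ∫⁻ s, k t s * φ s ∂logMeasure :=
  Measurable.lintegral_prod_right' (f := fun z : ℝ × ℝ => k z.1 z.2 * φ z.2)
    (hk.mul (hφ.comp measurable_snd))

end Hardy

theorem lorentzNorm_eq_logNorm {α : Type*} [MeasurableSpace α] (μ : Measure α) (p : ℝ≥0∞)
    {q : ℝ≥0∞} (hq : 1 ≤ q) (f : α → ℝ) :
    lorentzNorm μ p q f = logNorm q fun t =>
      ENNReal.ofReal (t ^ p.toReal⁻¹) * decRearr μ (fun x => ‖f x‖ₑ) t := by
  have hr : rearrangement μ f = decRearr μ fun x => ‖f x‖ₑ := rfl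
  unfold lorentzNorm
  rw [hr]
  split_ifs with hq'
  · rw [hq', logNorm_top]
  have h1 := one_le_toReal hq hq'
  have h0 : 0 ≤ q.toReal := by positivity
  have hm : Measurable fun t : ℝ =>
      ENNReal.ofReal (t ^ p.toReal⁻¹) * decRearr μ (fun x => ‖f x‖ₑ) t :=
    (ENNReal.measurable_ofReal.comp (measurable_id.pow_const _)).mul (measurable_decRearr _)
  rw [logNorm_of_ne_top hq', lintegral_logMeasure (hm.pow_const _)]
  congr 1
  refine setLIntegral_congr_fun measurableSet_Ioi fun t (ht : 0 < t) => ?_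
  rw [sub_eq_add_neg, Real.rpow_add ht, ENNReal.ofReal_mul (by positivity),
    mul_comm (ENNReal.ofReal (t ^ p.toReal⁻¹)), mul_assoc, ENNReal.mul_rpow_of_nonneg _ _ h0,
    ENNReal.ofReal_rpow_of_nonneg (by positivity) h0, ← Real.rpow_mul ht.le]
  congr 2
  rw [neg_mul, inv_mul_cancel₀ (by positivity), Real.rpow_neg_one]

theorem toReal_inv_pos_lt_one {p : ℝ≥0∞} (hp : 1 < p) (hp' : p ≠ ∞) :
    0 < p.toReal⁻¹ ∧ p.toReal⁻¹ < 1 := by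
  have h : 1 < p.toReal := by simpa using ENNReal.toReal_strict_mono hp' hp
  exact ⟨by positivity, inv_lt_one_of_one_lt₀ h⟩

/-- Young's convolution inequality in Lorentz spaces: convolution is bounded
from `L^{p,q}(ℝⁿ) × L^{p₁,q₁}(ℝⁿ)` to `L^{p₂,q₂}(ℝⁿ)` when `1 + 1/p₂ = 1/p + 1/p₁` and
`1/q₂ = 1/q + 1/q₁`. -/
theorem lorentzNorm_conv_young (n : ℕ) (p q p₁ q₁ p₂ q₂ : ℝ≥0∞)
    (hp : 1 < p) (hp' : p ≠ ∞) (hp₁ : 1 < p₁) (hp₁' : p₁ ≠ ∞) (hp₂ : 1 < p₂) (hp₂' : p₂ ≠ ∞)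
    (hq : 1 ≤ q) (hq₁ : 1 ≤ q₁) (hq₂ : 1 ≤ q₂)
    (hpc : 1 + p₂⁻¹ = p⁻¹ + p₁⁻¹) (hqc : q₂⁻¹ = q⁻¹ + q₁⁻¹) :
    ∃ C : ℝ≥0∞, C < ∞ ∧ ∀ f g : EuclideanSpace ℝ (Fin n) → ℝ,
      Measurable f → Measurable g →
      lorentzNorm volume p₂ q₂ (conv f g) ≤
        C * lorentzNorm volume p q f * lorentzNorm volume p₁ q₁ g := by
  obtain ⟨-, hβ1⟩ := toReal_inv_pos_lt_one hp hp'
  obtain ⟨-, hβ₁1⟩ := toReal_inv_pos_lt_one hp₁ hp₁'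
  obtain ⟨hγ0, -⟩ := toReal_inv_pos_lt_one hp₂ hp₂'
  have hsum : p.toReal⁻¹ + p₁.toReal⁻¹ = p₂.toReal⁻¹ + 1 := by
    have h := congrArg ENNReal.toReal hpc
    have hne : ∀ {r : ℝ≥0∞}, 1 < r → r⁻¹ ≠ ∞ := fun hr => by
      simpa using (zero_lt_one.trans hr).ne'
    rw [ENNReal.toReal_add (by simp) (hne hp₂), ENNReal.toReal_add (hne hp) (hne hp₁)] at h
    simp only [ENNReal.toReal_one, ENNReal.toReal_inv] at h
    linarith
  set β := p.toReal⁻¹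
  set β₁ := p₁.toReal⁻¹
  set γ := p₂.toReal⁻¹
  refine ⟨4 * ENNReal.ofReal (1 - β)⁻¹ * ENNReal.ofReal (1 - β₁)⁻¹ + ENNReal.ofReal γ⁻¹, ?_, ?_⟩
  · exact ENNReal.add_lt_top.2 ⟨ENNReal.mul_lt_top (ENNReal.mul_lt_top (by simp)
      ENNReal.ofReal_lt_top) ENNReal.ofReal_lt_top, ENNReal.ofReal_lt_top⟩
  intro f g hf hg
  rw [lorentzNorm_eq_logNorm _ _ hq, lorentzNorm_eq_logNorm _ _ hq₁,
    lorentzNorm_eq_logNorm _ _ hq₂]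
  have hF : Measurable fun x => ‖f x‖ₑ := hf.enorm
  have hG : Measurable fun x => ‖g x‖ₑ := hg.enorm
  set F := fun x => ‖f x‖ₑ
  set G := fun x => ‖g x‖ₑ
  have hpow : ∀ c : ℝ, Measurable fun t : ℝ => ENNReal.ofReal (t ^ c) := fun c =>
    ENNReal.measurable_ofReal.comp (measurable_id.pow_const c)
  set a : ℝ → ℝ≥0∞ := fun t => ENNReal.ofReal (t ^ β) * decRearr volume F t
  set b : ℝ → ℝ≥0∞ := fun t => ENNReal.ofReal (t ^ β₁) * decRearr volume G t
  have ha : Measurable a := (hpow β).mul (measurable_decRearr F)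
  have hb : Measurable b := (hpow β₁).mul (measurable_decRearr G)
  set Ta : ℝ → ℝ≥0∞ := fun t => ∫⁻ s, hardyKernel (1 - β) t s * a s ∂logMeasure
  set Tb : ℝ → ℝ≥0∞ := fun t => ∫⁻ s, hardyKernel (1 - β₁) t s * b s ∂logMeasure
  set Tab : ℝ → ℝ≥0∞ := fun t => ∫⁻ s, hardyKernel γ s t * (a s * b s) ∂logMeasure
  have hTa : Measurable Ta := measurable_lintegral_kernel_mul (measurable_hardyKernel _) ha
  have hTb : Measurable Tb := measurable_lintegral_kernel_mul (measurable_hardyKernel _) hb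
  have hswap : Measurable (Function.uncurry fun t s => hardyKernel γ s t) :=
    (measurable_hardyKernel γ).comp measurable_swap
  have hTab : Measurable Tab := measurable_lintegral_kernel_mul hswap (ha.mul hb)
  have hpoint : ∀ t, 0 < t → ENNReal.ofReal (t ^ γ) * decRearr volume (fun x => ‖conv f g x‖ₑ) t ≤
      4 * (Ta t * Tb t) + Tab t := by
    intro t ht
    have hconv : (fun x => ‖conv f g x‖ₑ) ≤ fun x => ∫⁻ y, F (x - y) * G y := fun x => by
      refine (enorm_integral_le_lintegral_enorm _).trans (le_of_eq ?_)
      simp only [enorm_mul, F, G]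
    have honeil := (decRearr_mono hconv t).trans (decRearr_lintegral_sub_mul_le hF hG ht)
    have e1 : Ta t = _ := (ofReal_rpow_mul_average_eq β ht (measurable_decRearr F)).symm
    have e2 : Tb t = _ := (ofReal_rpow_mul_average_eq β₁ ht (measurable_decRearr G)).symm
    have hprod : ∀ s : ℝ, 0 < s →
        ENNReal.ofReal (s ^ β) * ENNReal.ofReal (s ^ β₁) = ENNReal.ofReal (s ^ (γ + 1)) :=
      fun s hs => by rw [← ENNReal.ofReal_mul (by positivity), ← Real.rpow_add hs, hsum]
    have e3 : Tab t = ENNReal.ofReal (t ^ γ) *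
        ∫⁻ s in Ioi t, decRearr volume F s * decRearr volume G s := by
      rw [ofReal_rpow_mul_tail_eq γ ht ((measurable_decRearr F).fun_mul (measurable_decRearr G))]
      refine lintegral_congr_ae ?_
      filter_upwards [ae_logMeasure_pos] with s hs
      simp only [a, b, ← hprod s hs]
      ring
    refine (mul_le_mul' le_rfl honeil).trans (le_of_eq ?_)
    have ht0 : ENNReal.ofReal t ≠ 0 := by simpa using ht
    have e4 : ENNReal.ofReal (t ^ γ) = ENNReal.ofReal (t ^ β) * ENNReal.ofReal (t ^ β₁) *
        (ENNReal.ofReal t)⁻¹ := by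
      rw [hprod t ht, Real.rpow_add_one ht.ne', ENNReal.ofReal_mul (by positivity), mul_assoc,
        ENNReal.mul_inv_cancel ht0 ENNReal.ofReal_ne_top, mul_one]
    rw [mul_add, ← e3, e1, e2, e4]
    simp only [div_eq_mul_inv]
    ring
  have hA : logNorm q Ta ≤ ENNReal.ofReal (1 - β)⁻¹ * logNorm q a :=
    logNorm_lintegral_le hq (measurable_hardyKernel _)
      (fun t ht => lintegral_hardyKernel (by linarith) ht)
      (fun t ht => lintegral_hardyKernel_swap (by linarith) ht) ha
  have hB : logNorm q₁ Tb ≤ ENNReal.ofReal (1 - β₁)⁻¹ * logNorm q₁ b :=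
    logNorm_lintegral_le hq₁ (measurable_hardyKernel _)
      (fun t ht => lintegral_hardyKernel (by linarith) ht)
      (fun t ht => lintegral_hardyKernel_swap (by linarith) ht) hb
  have hAB : logNorm q₂ Tab ≤ ENNReal.ofReal γ⁻¹ * logNorm q₂ fun t => a t * b t :=
    logNorm_lintegral_le hq₂ hswap
      (fun t ht => lintegral_hardyKernel_swap hγ0 ht)
      (fun t ht => lintegral_hardyKernel hγ0 ht) (ha.mul hb)
  calc _ ≤ logNorm q₂ fun t => 4 * (Ta t * Tb t) + Tab t := logNorm_mono _ hpoint
    _ ≤ 4 * (logNorm q Ta * logNorm q₁ Tb) + logNorm q₂ Tab := by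
      refine (logNorm_add_le hq₂ ((hTa.mul hTb).const_mul 4) hTab).trans (add_le_add ?_ le_rfl)
      exact (logNorm_const_mul_le hq₂ 4 (hTa.mul hTb)).trans
        (mul_le_mul' le_rfl (logNorm_mul_le hq hq₁ hq₂ hqc hTa hTb))
    _ ≤ 4 * ((ENNReal.ofReal (1 - β)⁻¹ * logNorm q a) *
          (ENNReal.ofReal (1 - β₁)⁻¹ * logNorm q₁ b)) +
        ENNReal.ofReal γ⁻¹ * (logNorm q a * logNorm q₁ b) := by
      refine add_le_add (mul_le_mul' le_rfl (mul_le_mul' hA hB)) (hAB.trans ?_)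
      exact mul_le_mul' le_rfl (logNorm_mul_le hq hq₁ hq₂ hqc ha hb)
    _ = _ := by ring
end
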